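/- Assume the continuum hypothesis (2^{ℵ₀} = ℵ₁). A von Neumann algebra M acting on a separable Hilbert space admits a classically normal, singular pure state if and only if there exists a central projection p ∈ M such that pMp is an infinite-dimensional factor (equivalently, a factor of type I_∞, II, or III). -/

import Mathlib

open scoped ComplexOrder InnerProductSpace
open Filter Topology

noncomputable instance {H : Type*} [NormedAddCommGroup H] [InnerProductSpace ℂ H]
    [CompleteSpace H] : SMulMemClass (VonNeumannAlgebra H) ℂ (H →L[ℂ] H) :=
  ⟨fun {s} c {_} hx => s.toStarSubalgebra.smul_mem hx c⟩

/-- The σ-weak (ultraweak, weak*) topology on `B(H)`: the initial topology induced by the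
functionals `x ↦ ∑' n, ⟪ξ n, x (η n)⟫` over all pairs of square-summable sequences. -/
noncomputable def sigmaWeak (H : Type*) [NormedAddCommGroup H] [InnerProductSpace ℂ H]
    [CompleteSpace H] : TopologicalSpace (H →L[ℂ] H) :=
  ⨅ (ξ : ℕ → H) (η : ℕ → H) (_ : Summable fun n => ‖ξ n‖ ^ 2)
    (_ : Summable fun n => ‖η n‖ ^ 2),
    TopologicalSpace.induced (fun x : H →L[ℂ] H => ∑' n, ⟪ξ n, x (η n)⟫_ℂ) inferInstance

variable {H : Type*} [NormedAddCommGroup H] [InnerProductSpace ℂ H] [CompleteSpace H]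

/-- A positive linear functional on a von Neumann algebra. -/
def IsPosFunctional (M : VonNeumannAlgebra H) (f : ↥M →ₗ[ℂ] ℂ) : Prop :=
  ∀ a : ↥M, 0 ≤ f (star a * a)

/-- A state on a von Neumann algebra: a positive linear functional sending `1` to `1`. -/
def IsStateOn (M : VonNeumannAlgebra H) (f : ↥M →ₗ[ℂ] ℂ) : Prop :=
  IsPosFunctional M f ∧ f 1 = 1

/-- A pure state: a state such that every positive linear functional it dominates is a
nonnegative scalar multiple of it. -/
def IsPureStateOn (M : VonNeumannAlgebra H) (f : ↥M →ₗ[ℂ] ℂ) : Prop :=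
  IsStateOn M f ∧ ∀ g : ↥M →ₗ[ℂ] ℂ, IsPosFunctional M g → IsPosFunctional M (f - g) →
    ∃ t : ℝ, 0 ≤ t ∧ g = (t : ℂ) • f

/-- A functional on a von Neumann algebra is normal if it is continuous for the σ-weak
topology. -/
def IsNormalOn (M : VonNeumannAlgebra H) (f : ↥M →ₗ[ℂ] ℂ) : Prop :=
  @Continuous ↥M ℂ
    (TopologicalSpace.induced (fun x : ↥M => (x : H →L[ℂ] H)) (sigmaWeak H)) _ f

/-- A state on a von Neumann algebra is singular if the only normal positive linear
functional it dominates is `0`. -/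
def IsSingularOn (M : VonNeumannAlgebra H) (f : ↥M →ₗ[ℂ] ℂ) : Prop :=
  ∀ g : ↥M →ₗ[ℂ] ℂ, IsPosFunctional M g → IsPosFunctional M (f - g) → IsNormalOn M g → g = 0

/-- A projection: a self-adjoint idempotent. -/
def IsProjection (p : H →L[ℂ] H) : Prop := star p = p ∧ p * p = p

/-- `q` is a subprojection of `p` (i.e. `q ≤ p` for projections). -/
def ProjLE (q p : H →L[ℂ] H) : Prop := q * p = q ∧ p * q = q

/-- `p` is a minimal projection of the set `S`: a nonzero projection in `S` such that the
only projections of `S` below `p` are `0` and `p`. -/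
def IsMinimalProjectionIn (S : Set (H →L[ℂ] H)) (p : H →L[ℂ] H) : Prop :=
  p ∈ S ∧ IsProjection p ∧ p ≠ 0 ∧
    ∀ q ∈ S, IsProjection q → ProjLE q p → q = 0 ∨ q = p

/-- `f` is multiplicative on the subset `C` of `M`. -/
def IsMultiplicativeOn (M : VonNeumannAlgebra H) (f : ↥M →ₗ[ℂ] ℂ)
    (C : Set (H →L[ℂ] H)) : Prop :=
  ∀ a b : ↥M, (a : H →L[ℂ] H) ∈ C → (b : H →L[ℂ] H) ∈ C → f (a * b) = f a * f b

/-- `f` is normal on the von Neumann subalgebra `C` of `M` (where `C ⊆ M`): the restriction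
of `f` to `C` is σ-weakly continuous. -/
def IsNormalOnSub (M : VonNeumannAlgebra H) (f : ↥M →ₗ[ℂ] ℂ) (C : VonNeumannAlgebra H)
    (hC : (C : Set (H →L[ℂ] H)) ⊆ M) : Prop :=
  @Continuous ↥C ℂ
    (TopologicalSpace.induced (fun x : ↥C => (x : H →L[ℂ] H)) (sigmaWeak H)) _
    (fun x => f ⟨x, hC x.2⟩)

/-- A state on `M` is classically normal if it is normal on every von Neumann subalgebra
of `M` (with the same unit) on which it is multiplicative. -/
def IsClassicallyNormalOn (M : VonNeumannAlgebra H) (f : ↥M →ₗ[ℂ] ℂ) : Prop :=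
  ∀ (C : VonNeumannAlgebra H) (hC : (C : Set (H →L[ℂ] H)) ⊆ M),
    IsMultiplicativeOn M f (C : Set (H →L[ℂ] H)) → IsNormalOnSub M f C hC

/-- A von Neumann algebra is a factor if its center consists of the scalar multiples of
the identity. -/
def IsFactor (N : VonNeumannAlgebra H) : Prop :=
  ∀ x ∈ N, (∀ y ∈ N, x * y = y * x) → ∃ c : ℂ, x = c • (1 : H →L[ℂ] H)

/-- A positive operator on a Hilbert space. -/
def IsPositiveOp (a : H →L[ℂ] H) : Prop :=
  star a = a ∧ ∀ v : H, 0 ≤ ⟪v, a v⟫_ℂ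

/-- The corner `pMp` of a von Neumann algebra `M` by a projection `p`. -/
def corner (M : VonNeumannAlgebra H) (p : H →L[ℂ] H) : Set (H →L[ℂ] H) :=
  (fun x => p * x * p) '' (M : Set (H →L[ℂ] H))

/-- The corner `pMp` (with unit `p`) is a factor: its center consists of the scalar
multiples of its unit `p`. -/
def CornerIsFactor (M : VonNeumannAlgebra H) (p : H →L[ℂ] H) : Prop :=
  ∀ x ∈ corner M p, (∀ y ∈ corner M p, x * y = y * x) → ∃ c : ℂ, x = c • p

section OrderUnit

variable {E : Type*} [AddCommGroup E] [Module ℝ E]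

/-- The states of a real vector space with positive cone `C` and order unit `e`, as functions. -/
def orderStates (C : PointedCone ℝ E) (e : E) : Set (E → ℝ) :=
  {φ | (∃ f : E →ₗ[ℝ] ℝ, ⇑f = φ) ∧ (∀ x ∈ C, 0 ≤ φ x) ∧ φ e = 1}

/-- The states taking prescribed values, the pair `(x, c)` prescribing the value `c` at `x`. -/
def orderStatesCut (C : PointedCone ℝ E) (e : E) (D : Set (E × ℝ)) : Set (E → ℝ) :=
  {φ | φ ∈ orderStates C e ∧ ∀ d ∈ D, φ d.1 = d.2}

/-- `e` is an order unit for the cone `C`. -/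
def IsOrderUnit (C : PointedCone ℝ E) (e : E) : Prop :=
  e ∈ C ∧ ∀ x : E, ∃ r : ℝ, r • e - x ∈ C

variable {C : PointedCone ℝ E} {e : E}

theorem PointedCone.real_smul_mem {x : E} (hx : x ∈ C) {r : ℝ} (hr : 0 ≤ r) : r • x ∈ C :=
  Submodule.smul_mem C (⟨r, hr⟩ : {c : ℝ // 0 ≤ c}) hx

theorem isClosed_orderStatesCut (D : Set (E × ℝ)) : IsClosed (orderStatesCut C e D) := by
  have h1 : IsClosed {φ : E → ℝ | ∃ f : E →ₗ[ℝ] ℝ, ⇑f = φ} :=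
    LinearMap.isClosed_range_coe E ℝ (RingHom.id ℝ)
  have h2 : IsClosed {φ : E → ℝ | ∀ x ∈ C, 0 ≤ φ x} := by
    simp only [Set.ofPred_forall]
    exact isClosed_iInter fun x => isClosed_iInter fun _ =>
      isClosed_le continuous_const (continuous_apply x)
  have h3 : IsClosed {φ : E → ℝ | φ e = 1} :=
    isClosed_eq (continuous_apply e) continuous_const
  have h4 : IsClosed {φ : E → ℝ | ∀ d ∈ D, φ d.1 = d.2} := by
    simp only [Set.ofPred_forall]
    exact isClosed_iInter fun d => isClosed_iInter fun _ =>
      isClosed_eq (continuous_apply _) continuous_const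
  exact (h1.inter (h2.inter h3)).inter h4

theorem isCompact_orderStatesCut (he : IsOrderUnit C e) (D : Set (E × ℝ)) :
    IsCompact (orderStatesCut C e D) := by
  choose r hr using he.2
  refine (isCompact_univ_pi fun x : E => isCompact_Icc (a := -(r (-x))) (b := r x)).of_isClosed_subset
    (isClosed_orderStatesCut D) ?_
  rintro φ ⟨⟨⟨f, rfl⟩, hpos, h1⟩, -⟩ x -
  have a1 := hpos _ (hr x)
  have a2 := hpos _ (hr (-x))
  simp only [map_sub, map_smul, h1, smul_eq_mul, mul_one, map_neg] at a1 a2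
  constructor <;> linarith

theorem orderStatesCut_empty : orderStatesCut C e ∅ = orderStates C e := by
  simp [orderStatesCut]

/-- A positive functional dominated by an extreme state is a multiple of it. -/
theorem eq_smul_of_le_extreme (he : IsOrderUnit C e) {g : E →ₗ[ℝ] ℝ}
    (hg : ⇑g ∈ (orderStates C e).extremePoints ℝ) (h : E →ₗ[ℝ] ℝ) (h0 : ∀ x ∈ C, 0 ≤ h x)
    (hle : ∀ x ∈ C, h x ≤ g x) : ∃ t : ℝ, 0 ≤ t ∧ h = t • g := by
  rw [mem_extremePoints] at hg
  obtain ⟨⟨-, -, g1⟩, hext⟩ := hg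
  have zero_of {k : E →ₗ[ℝ] ℝ} (hk : ∀ x ∈ C, 0 ≤ k x) (hk1 : k e = 0) : k = 0 := by
    ext x
    obtain ⟨r, hr⟩ := he.2 x
    obtain ⟨s, hs⟩ := he.2 (-x)
    have a1 := hk _ hr
    have a2 := hk _ hs
    simp only [map_sub, map_smul, hk1, smul_eq_mul, mul_zero, map_neg] at a1 a2
    simp only [LinearMap.zero_apply]
    linarith
  have hs0 : 0 ≤ h e := h0 _ he.1
  have hs1 : h e ≤ 1 := g1 ▸ hle _ he.1
  rcases hs0.eq_or_lt with hs | hs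
  · exact ⟨0, le_rfl, by rw [zero_of h0 hs.symm, zero_smul]⟩
  rcases hs1.eq_or_lt with hs' | hs'
  · refine ⟨1, zero_le_one, ?_⟩
    have := zero_of (k := g - h) (fun x hx => by simpa using hle x hx) (by simp [g1, hs'])
    rw [one_smul, eq_comm, ← sub_eq_zero, this]
  have hs1' : 0 < 1 - h e := by linarith
  have key := hext (⇑((h e)⁻¹ • h)) ⟨⟨_, rfl⟩, fun x hx => ?_, ?_⟩
    (⇑((1 - h e)⁻¹ • (g - h))) ⟨⟨_, rfl⟩, fun x hx => ?_, ?_⟩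
    ⟨h e, 1 - h e, hs, hs1', by ring, ?_⟩
  · refine ⟨h e, hs0, ?_⟩
    ext x
    have := congrFun key.1 x
    simp only [LinearMap.smul_apply, smul_eq_mul] at this ⊢
    rw [← this]
    field_simp
  · exact mul_nonneg (inv_nonneg.2 hs0) (h0 x hx)
  · simp [hs.ne']
  · exact mul_nonneg (inv_nonneg.2 hs1'.le) (by simpa using hle x hx)
  · simp [g1, hs1'.ne']
  · ext x
    simp only [Pi.add_apply, Pi.smul_apply, LinearMap.smul_apply, smul_eq_mul,
      LinearMap.sub_apply]
    field_simp
    ring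

/-- An element in the kernel of an extreme state `g` is dominated by a positive element on
which `g` is arbitrarily small. -/
theorem exists_dominating_of_extreme (he : IsOrderUnit C e) {g : E →ₗ[ℝ] ℝ}
    (hg : ⇑g ∈ (orderStates C e).extremePoints ℝ) {x : E} (hx : g x = 0) {ε : ℝ} (hε : 0 < ε) :
    ∃ d ∈ C, d - x ∈ C ∧ g d < ε := by
  rcases eq_or_ne x 0 with rfl | hx0
  · exact ⟨0, C.zero_mem, by simp, by simpa using hε⟩
  have hpos : ∀ y ∈ C, 0 ≤ g y := hg.1.2.1
  let V (y : E) : Set ℝ := {c | ∃ d ∈ C, d - y ∈ C ∧ g d = c}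
  have V_bdd (y : E) : BddBelow (V y) := ⟨0, by rintro _ ⟨d, hd, -, rfl⟩; exact hpos d hd⟩
  have V_ne (y : E) : (V y).Nonempty := by
    obtain ⟨r, hr⟩ := he.2 y
    refine ⟨_, max r 0 • e, PointedCone.real_smul_mem he.1 (le_max_right _ _), ?_, rfl⟩
    have := C.add_mem hr (PointedCone.real_smul_mem he.1 (sub_nonneg.2 (le_max_left r 0)))
    rwa [sub_smul, sub_add_sub_comm, add_comm y, add_sub_add_left_eq_sub] at this
  let N (y : E) : ℝ := sInf (V y)
  have N_nonneg (y : E) : 0 ≤ N y :=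
    le_csInf (V_ne y) (by rintro _ ⟨d, hd, -, rfl⟩; exact hpos d hd)
  have N_le {y d : E} (hd : d ∈ C) (hdy : d - y ∈ C) : N y ≤ g d :=
    csInf_le (V_bdd y) ⟨d, hd, hdy, rfl⟩
  have N_smul_le (c : ℝ) (hc : 0 < c) (y : E) : N (c • y) ≤ c * N y := by
    rw [← div_le_iff₀' hc]
    refine le_csInf (V_ne y) ?_
    rintro _ ⟨d, hd, hdy, rfl⟩
    rw [div_le_iff₀' hc, ← smul_eq_mul, ← map_smul]
    refine N_le (PointedCone.real_smul_mem hd hc.le) ?_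
    rw [← smul_sub]
    exact PointedCone.real_smul_mem hdy hc.le
  have N_smul (c : ℝ) (hc : 0 < c) (y : E) : N (c • y) = c * N y := by
    refine le_antisymm (N_smul_le c hc y) ?_
    have := N_smul_le c⁻¹ (inv_pos.2 hc) (c • y)
    rwa [smul_smul, inv_mul_cancel₀ hc.ne', one_smul, le_inv_mul_iff₀ hc] at this
  have N_add (y z : E) : N (y + z) ≤ N y + N z := by
    rw [← sub_le_iff_le_add]
    refine le_csInf (V_ne y) ?_
    rintro _ ⟨d, hd, hdy, rfl⟩
    rw [sub_le_comm]
    refine le_csInf (V_ne z) ?_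
    rintro _ ⟨d', hd', hdz, rfl⟩
    rw [sub_le_iff_le_add', ← map_add]
    refine N_le (C.add_mem hd hd') ?_
    rw [add_sub_add_comm]
    exact C.add_mem hdy hdz
  obtain ⟨h, hext, hle⟩ := exists_extension_of_le_sublinear
    (LinearPMap.mkSpanSingleton (σ := RingHom.id ℝ) x (N x) hx0) N N_smul N_add (by
      rintro ⟨y, hy⟩
      obtain ⟨c, rfl⟩ := Submodule.mem_span_singleton.1 hy
      erw [LinearPMap.mkSpanSingleton'_apply]
      simp only [RingHom.id_apply, smul_eq_mul]
      rcases le_or_gt c 0 with hc | hc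
      · exact (mul_nonpos_of_nonpos_of_nonneg hc (N_nonneg x)).trans (N_nonneg _)
      · exact (N_smul c hc x).ge)
  have hxN : h x = N x := by
    have := hext ⟨x, Submodule.mem_span_singleton_self x⟩
    rwa [LinearPMap.mkSpanSingleton_apply] at this
  obtain ⟨t, -, rfl⟩ := eq_smul_of_le_extreme he hg h
    (fun y hy => by
      have := (hle (-y)).trans (N_le (d := 0) C.zero_mem (by simpa using hy))
      simpa using this)
    (fun y hy => (hle y).trans (N_le hy (by simp)))
  have : N x < ε := by
    rw [← hxN]
    simpa [hx] using hε
  obtain ⟨_, ⟨d, hd, hdx, rfl⟩, hlt⟩ := exists_lt_of_csInf_lt (V_ne x) this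
  exact ⟨d, hd, hdx, hlt⟩

/-- Two-sided version of `exists_dominating_of_extreme` for finitely many elements. -/
theorem exists_dominating_finset (he : IsOrderUnit C e) {g : E →ₗ[ℝ] ℝ}
    (hg : ⇑g ∈ (orderStates C e).extremePoints ℝ) (s : Finset E) {ε : ℝ} (hε : 0 < ε) :
    ∃ d ∈ C, (∀ x ∈ s, d - (x - g x • e) ∈ C ∧ d + (x - g x • e) ∈ C) ∧ g d < ε := by
  classical
  have g1 : g e = 1 := hg.1.2.2
  induction s using Finset.induction_on generalizing ε with
  | empty => exact ⟨0, C.zero_mem, by simp, by simpa using hε⟩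
  | insert x s _ ih =>
    obtain ⟨d, hd, hds, hdε⟩ := ih (half_pos hε)
    obtain ⟨a, ha, hax, haε⟩ := exists_dominating_of_extreme he hg (x := x - g x • e)
      (by simp [g1]) (half_pos (half_pos hε))
    obtain ⟨b, hb, hbx, hbε⟩ := exists_dominating_of_extreme he hg (x := -(x - g x • e))
      (by simp [g1]) (half_pos (half_pos hε))
    refine ⟨d + (a + b), C.add_mem hd (C.add_mem ha hb), fun y hy => ?_, ?_⟩
    · rcases Finset.mem_insert.1 hy with rfl | hy
      · constructor
        · convert C.add_mem (C.add_mem hd hb) hax using 1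
          abel
        · convert C.add_mem (C.add_mem hd ha) hbx using 1
          abel
      · constructor
        · convert C.add_mem (C.add_mem ha hb) (hds y hy).1 using 1
          abel
        · convert C.add_mem (C.add_mem ha hb) (hds y hy).2 using 1
          abel
    · simp only [map_add]
      linarith

/-- The face of a compact set of states on which `x` is maximal, cut out by one more value. -/
theorem exists_max_cut (he : IsOrderUnit C e) {D : Set (E × ℝ)}
    (hne : (orderStatesCut C e D).Nonempty) (x : E) :
    ∃ c : ℝ, (orderStatesCut C e (insert (x, c) D)).Nonempty ∧
      (∀ ψ ∈ orderStatesCut C e D, ψ x ≤ c) := by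
  obtain ⟨φ, hφ, hmax⟩ := (isCompact_orderStatesCut he D).exists_isMaxOn hne
    (continuous_apply x).continuousOn
  refine ⟨φ x, ⟨φ, hφ.1, ?_⟩, fun ψ hψ => hmax hψ⟩
  rintro d (rfl | hd)
  exacts [rfl, hφ.2 d hd]

theorem isExtreme_cut_insert {D : Set (E × ℝ)} {x : E} {c : ℝ}
    (hD : IsExtreme ℝ (orderStates C e) (orderStatesCut C e D))
    (hc : ∀ ψ ∈ orderStatesCut C e D, ψ x ≤ c) :
    IsExtreme ℝ (orderStates C e) (orderStatesCut C e (insert (x, c) D)) := by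
  refine hD.trans ⟨fun φ hφ => ⟨hφ.1, fun d hd => hφ.2 d (Or.inr hd)⟩, ?_⟩
  rintro φ hφ ψ hψ χ hχ ⟨a, b, ha, hb, hab, rfl⟩
  refine ⟨hφ.1, ?_⟩
  rintro d (rfl | hd)
  · have h1 := hχ.2 (x, c) (Or.inl rfl)
    simp only [Pi.add_apply, Pi.smul_apply, smul_eq_mul] at h1
    refine le_antisymm (hc φ hφ) ?_
    have h2 := mul_le_mul_of_nonneg_left (hc ψ hψ) hb.le
    refine le_of_mul_le_mul_left ?_ ha
    have h3 : a * c + b * c = c := by rw [← add_mul, hab, one_mul]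
    change a * c ≤ a * φ x
    linarith
  · exact hφ.2 d hd

/-- Along a well order with countable initial segments one can thin out a face of states so that
each of the requirements `good i` is met by an extreme state, as soon as every face cut out by
countably many values has an element whose maximisers meet the requirement. -/
theorem exists_extreme_state_forall_good {ι : Type*} [LinearOrder ι] [WellFoundedLT ι]
    (hι : ∀ i : ι, (Set.Iio i).Countable) (he : IsOrderUnit C e) (good : ι → (E → ℝ) → Prop)
    {D₀ : Set (E × ℝ)} (hD₀ : D₀.Countable) (hne : (orderStatesCut C e D₀).Nonempty)
    (hext : IsExtreme ℝ (orderStates C e) (orderStatesCut C e D₀))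
    (step : ∀ i, ∀ D : Set (E × ℝ), D.Countable → D₀ ⊆ D → (orderStatesCut C e D).Nonempty →
      IsExtreme ℝ (orderStates C e) (orderStatesCut C e D) →
      ∃ x : E, ∀ φ ∈ orderStatesCut C e D, (∀ ψ ∈ orderStatesCut C e D, ψ x ≤ φ x) → good i φ) :
    ∃ φ ∈ orderStatesCut C e D₀, φ ∈ (orderStates C e).extremePoints ℝ ∧ ∀ i, good i φ := by
  classical
  let next (i : ι) (D : Set (E × ℝ)) (d : E × ℝ) : Prop :=
    (orderStatesCut C e (insert d D)).Nonempty ∧ (∀ ψ ∈ orderStatesCut C e D, ψ d.1 ≤ d.2) ∧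
      ∀ φ ∈ orderStatesCut C e (insert d D), good i φ
  let pick (i : ι) (D : Set (E × ℝ)) : E × ℝ :=
    if h : ∃ d, next i D d then h.choose else 0
  let below (i : ι) (F : ∀ j, j < i → E × ℝ) : Set (E × ℝ) := D₀ ∪ {d | ∃ j hj, F j hj = d}
  let d : ι → E × ℝ := (wellFounded_lt (α := ι)).fix fun i F => pick i (below i F)
  let D (i : ι) : Set (E × ℝ) := D₀ ∪ d '' Set.Iio i
  have d_eq (i : ι) : d i = pick i (D i) := by
    have h1 : d i = pick i (below i fun j _ => d j) := WellFounded.fix_eq _ _ i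
    rw [h1]
    congr 1
    ext y
    simp [below, D]
  have D_countable (i : ι) : (D i).Countable := hD₀.union ((hι i).image d)
  have D_mono {i j : ι} (hij : i < j) : insert (d i) (D i) ⊆ D j := by
    rintro y (rfl | hy | ⟨k, hk, rfl⟩)
    · exact Or.inr ⟨i, hij, rfl⟩
    · exact Or.inl hy
    · exact Or.inr ⟨k, lt_trans hk hij, rfl⟩
  have cut_anti {A B : Set (E × ℝ)} (h : A ⊆ B) : orderStatesCut C e B ⊆ orderStatesCut C e A :=
    fun φ hφ => ⟨hφ.1, fun y hy => hφ.2 y (h hy)⟩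
  have next_of {i : ι} (h1 : (orderStatesCut C e (D i)).Nonempty)
      (h2 : IsExtreme ℝ (orderStates C e) (orderStatesCut C e (D i))) : next i (D i) (d i) := by
    have : ∃ y, next i (D i) y := by
      obtain ⟨x, hx⟩ := step i (D i) (D_countable i) Set.subset_union_left h1 h2
      obtain ⟨c, hc1, hc2⟩ := exists_max_cut he h1 x
      refine ⟨(x, c), hc1, hc2, fun φ hφ => hx φ (cut_anti (Set.subset_insert _ _) hφ) ?_⟩
      intro ψ hψ
      rw [hφ.2 (x, c) (Or.inl rfl)]
      exact hc2 ψ hψ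
    rw [d_eq]
    simp only [pick, dif_pos this]
    exact this.choose_spec
  have inter_props (J : Set ι) (hJ : ∀ i ∈ J, (orderStatesCut C e (D i)).Nonempty ∧
      IsExtreme ℝ (orderStates C e) (orderStatesCut C e (D i))) :
      (orderStatesCut C e (D₀ ∪ ⋃ i ∈ J, insert (d i) (D i))).Nonempty ∧
      IsExtreme ℝ (orderStates C e) (orderStatesCut C e (D₀ ∪ ⋃ i ∈ J, insert (d i) (D i))) := by
    rcases J.eq_empty_or_nonempty with rfl | hJne
    · simpa using ⟨hne, hext⟩
    have := hJne.to_subtype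
    have key : orderStatesCut C e (D₀ ∪ ⋃ i ∈ J, insert (d i) (D i)) =
        ⋂ i : J, orderStatesCut C e (insert (d i) (D i)) := by
      ext φ
      simp only [Set.mem_iInter]
      constructor
      · intro hφ i
        exact cut_anti (fun y hy => Or.inr (Set.mem_biUnion i.2 hy)) hφ
      · intro hφ
        obtain ⟨i, hi⟩ := hJne
        refine ⟨(hφ ⟨i, hi⟩).1, ?_⟩
        rintro y (hy | hy)
        · exact (hφ ⟨i, hi⟩).2 y (Or.inr (Or.inl hy))
        · obtain ⟨j, hj, hy⟩ := Set.mem_iUnion₂.1 hy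
          exact (hφ ⟨j, hj⟩).2 y hy
    rw [key]
    refine ⟨IsCompact.nonempty_iInter_of_directed_nonempty_isCompact_isClosed _ ?_
      (fun i => (next_of (hJ i i.2).1 (hJ i i.2).2).1) (fun i => isCompact_orderStatesCut he _)
      (fun i => isClosed_orderStatesCut _), isExtreme_iInter fun i =>
        isExtreme_cut_insert (hJ i i.2).2 (next_of (hJ i i.2).1 (hJ i i.2).2).2.1⟩
    have aux {i j : J} (hij : i ≤ j) : orderStatesCut C e (insert (d j) (D j)) ⊆
        orderStatesCut C e (insert (d i) (D i)) := by
      rcases hij.eq_or_lt with rfl | hij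
      · rfl
      · exact cut_anti ((D_mono hij).trans (Set.subset_insert _ _))
    intro i j
    rcases le_total i j with hij | hij
    · exact ⟨j, aux hij, subset_rfl⟩
    · exact ⟨i, subset_rfl, aux hij⟩
  have D_props (i : ι) : (orderStatesCut C e (D i)).Nonempty ∧
      IsExtreme ℝ (orderStates C e) (orderStatesCut C e (D i)) := by
    induction i using WellFoundedLT.induction with
    | ind i ih =>
      have := inter_props (Set.Iio i) ih
      have hD : D i = D₀ ∪ ⋃ j ∈ Set.Iio i, insert (d j) (D j) := by
        apply subset_antisymm
        · rintro y (hy | ⟨j, hj, rfl⟩)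
          · exact Or.inl hy
          · exact Or.inr (Set.mem_biUnion hj (Or.inl rfl))
        · rintro y (hy | hy)
          · exact Or.inl hy
          · obtain ⟨j, hj, hy⟩ := Set.mem_iUnion₂.1 hy
            exact D_mono hj hy
      rwa [hD]
  obtain ⟨h1, h2⟩ := inter_props Set.univ fun i _ => D_props i
  obtain ⟨φ, hφ⟩ := (isCompact_orderStatesCut he _).extremePoints_nonempty h1
  refine ⟨φ, cut_anti Set.subset_union_left hφ.1, h2.extremePoints_subset_extremePoints hφ,
    fun i => (next_of (D_props i).1 (D_props i).2).2.2 φ (cut_anti ?_ hφ.1)⟩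
  exact fun y hy => Or.inr (Set.mem_biUnion (Set.mem_univ i) hy)

end OrderUnit

section Operators

theorem nonneg_iff_re_inner {x : H →L[ℂ] H} (hx : IsSelfAdjoint x) :
    0 ≤ x ↔ ∀ v, 0 ≤ (⟪v, x v⟫_ℂ).re := by
  rw [ContinuousLinearMap.nonneg_iff_isPositive, ContinuousLinearMap.isPositive_def]
  refine ⟨fun h v => ?_, fun h => ⟨hx.isSymmetric, fun v => ?_⟩⟩
  · have := h.2 v
    rwa [ContinuousLinearMap.reApplyInnerSelf_apply, inner_re_symm] at this
  · rw [ContinuousLinearMap.reApplyInnerSelf_apply, inner_re_symm]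
    exact h v

theorem re_inner_nonneg {x : H →L[ℂ] H} (hx : 0 ≤ x) (v : H) : 0 ≤ (⟪v, x v⟫_ℂ).re :=
  (nonneg_iff_re_inner (.of_nonneg hx)).1 hx v

theorem re_inner_mono {x y : H →L[ℂ] H} (hxy : x ≤ y) (v : H) :
    (⟪v, x v⟫_ℂ).re ≤ (⟪v, y v⟫_ℂ).re := by
  have := re_inner_nonneg (sub_nonneg.2 hxy) v
  simpa [inner_sub_right] using this

theorem IsSelfAdjoint.inner_left {x : H →L[ℂ] H} (hx : IsSelfAdjoint x) (v w : H) :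
    ⟪x v, w⟫_ℂ = ⟪v, x w⟫_ℂ :=
  hx.isSymmetric v w

theorem IsProjection.isSelfAdjoint {q : H →L[ℂ] H} (hq : IsProjection q) : IsSelfAdjoint q := hq.1

theorem IsProjection.apply_apply {q : H →L[ℂ] H} (hq : IsProjection q) (v : H) :
    q (q v) = q v :=
  congr($(hq.2) v)

theorem IsProjection.re_inner {q : H →L[ℂ] H} (hq : IsProjection q) (v : H) :
    (⟪v, q v⟫_ℂ).re = ‖q v‖ ^ 2 := by
  conv_lhs => rw [← hq.apply_apply, ← hq.isSelfAdjoint.inner_left]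
  exact inner_self_eq_norm_sq (𝕜 := ℂ) (q v)

theorem IsProjection.nonneg {q : H →L[ℂ] H} (hq : IsProjection q) : 0 ≤ q :=
  (nonneg_iff_re_inner hq.1).2 fun v => by rw [hq.re_inner]; positivity

theorem IsProjection.one_sub {q : H →L[ℂ] H} (hq : IsProjection q) : IsProjection (1 - q) := by
  refine ⟨by simp [hq.1], ?_⟩
  simp [sub_mul, mul_sub, hq.2]

theorem IsProjection.norm_apply_le {q : H →L[ℂ] H} (hq : IsProjection q) (v : H) :
    ‖q v‖ ≤ ‖v‖ := by
  have h1 := hq.re_inner v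
  have h2 : (⟪v, q v⟫_ℂ).re ≤ ‖v‖ * ‖q v‖ := re_inner_le_norm (𝕜 := ℂ) v (q v)
  by_contra! h
  nlinarith [norm_nonneg v, norm_nonneg (q v)]

theorem isProjection_starProjection (K : Submodule ℂ H) [K.HasOrthogonalProjection] :
    IsProjection K.starProjection :=
  ⟨isStarProjection_starProjection.isSelfAdjoint, isStarProjection_starProjection.isIdempotentElem⟩

namespace VonNeumannAlgebra

variable {M : VonNeumannAlgebra H}

theorem mem_of_forall_commute {x : H →L[ℂ] H} (h : ∀ y ∈ M.commutant, Commute x y) : x ∈ M := by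
  rw [← M.commutant_commutant]
  exact mem_commutant_iff.2 fun y hy => (h y hy).symm

theorem commute_of_mem {x y : H →L[ℂ] H} (hx : x ∈ M) (hy : y ∈ M.commutant) : Commute x y :=
  mem_commutant_iff.1 hy x hx

theorem cfc_mem {x : H →L[ℂ] H} (hx : x ∈ M) (hsa : IsSelfAdjoint x) (f : ℝ → ℝ) :
    cfc f x ∈ M :=
  mem_of_forall_commute fun _ hy => hsa.commute_cfc (commute_of_mem hx hy) f

theorem real_smul_mem {x : H →L[ℂ] H} (hx : x ∈ M) (r : ℝ) : r • x ∈ M := by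
  rw [← Complex.coe_smul]
  exact SMulMemClass.smul_mem (r : ℂ) hx

theorem starProjection_mem (K : Submodule ℂ H) [K.HasOrthogonalProjection]
    (h : ∀ y ∈ M.commutant, ∀ v ∈ K, y v ∈ K) : K.starProjection ∈ M := by
  rw [IsStarProjection.mem_iff isStarProjection_starProjection]
  intro y hy
  rw [Submodule.range_starProjection]
  exact fun v hv => h y hy v hv

theorem mem_of_tendsto {x : ℕ → H →L[ℂ] H} {z : H →L[ℂ] H} (hx : ∀ n, x n ∈ M)
    (h : ∀ v, Tendsto (fun n => x n v) atTop (𝓝 (z v))) : z ∈ M := by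
  refine mem_of_forall_commute fun y hy => ?_
  ext v
  refine tendsto_nhds_unique (h (y v)) ?_
  refine ((y.continuous.tendsto _).comp (h v)).congr fun n => ?_
  exact congr($((commute_of_mem (hx n) hy).eq) v).symm

end VonNeumannAlgebra

open VonNeumannAlgebra

/-- For self-adjoint `D ∈ M` and `δ`, an operator `a ∈ M` supported where `D ≤ δ`. -/
theorem exists_spectral_cut {M : VonNeumannAlgebra H} {D : H →L[ℂ] H} (hD : D ∈ M)
    (hsa : IsSelfAdjoint D) (δ : ℝ) :
    ∃ a ∈ M, IsSelfAdjoint a ∧ (∀ v, (⟪a v, D (a v)⟫_ℂ).re ≤ δ * ‖a v‖ ^ 2) ∧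
      ∀ v, a v = 0 → δ * ‖v‖ ^ 2 ≤ (⟪v, D v⟫_ℂ).re := by
  have hc : cfc (fun t : ℝ => δ - t) D = δ • 1 - D := by
    rw [cfc_sub _ _ D, cfc_const δ D, cfc_id' ℝ D, Algebra.algebraMap_eq_smul_one]
  have hexp (v : H) : (⟪v, (δ • (1 : H →L[ℂ] H) - D) v⟫_ℂ).re =
      δ * ‖v‖ ^ 2 - (⟪v, D v⟫_ℂ).re := by
    have : (⟪v, δ • v⟫_ℂ) = ((δ * ‖v‖ ^ 2 : ℝ) : ℂ) := by
      rw [← Complex.coe_smul, inner_smul_right, inner_self_eq_norm_sq_to_K]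
      push_cast
      rfl
    simp [this, -Complex.ofReal_mul, -Complex.ofReal_pow]
  refine ⟨cfc (fun t : ℝ => max (δ - t) 0) D, cfc_mem hD hsa _, cfc_predicate _ _, fun v => ?_,
    fun v hv => ?_⟩
  · have h : 0 ≤ cfc (fun t : ℝ => max (δ - t) 0) D * (δ • 1 - D) *
        cfc (fun t : ℝ => max (δ - t) 0) D := by
      rw [← hc, ← cfc_mul (fun t : ℝ => max (δ - t) 0) _ D, ← cfc_mul _ _ D]
      refine cfc_nonneg fun t _ => ?_
      rcases le_total (δ - t) 0 with h | h
      · simp [h]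
      · positivity
    have := re_inner_nonneg h v
    rw [mul_apply_eq_comp, mul_apply_eq_comp,
      ← IsSelfAdjoint.inner_left (cfc_predicate _ _), hexp] at this
    linarith
  · have h : δ • 1 - D ≤ cfc (fun t : ℝ => max (δ - t) 0) D := by
      rw [← hc]
      exact cfc_mono fun t _ => le_max_left _ _
    have := re_inner_mono h v
    rw [hexp, hv, inner_zero_right, Complex.zero_re] at this
    linarith

/-- In a corner that is a factor, any two nonzero operators are connected. -/
theorem exists_mul_mul_ne_zero {M : VonNeumannAlgebra H} {p : H →L[ℂ] H} (hpM : p ∈ M)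
    (hp : IsProjection p) (hcen : ∀ x ∈ M, p * x = x * p) (hfac : CornerIsFactor M p)
    {a b : H →L[ℂ] H} (hb : b ∈ M) (hap : a * p ≠ 0) (hbp : b * p ≠ 0) :
    ∃ y ∈ M, a * y * b ≠ 0 := by
  by_contra! hzero
  let s : Set H := {w | ∃ y ∈ M, ∃ v, y ((b * p) v) = w}
  let K : Submodule ℂ H := (Submodule.span ℂ s).topologicalClosure
  have hinv (T : H →L[ℂ] H) (hT : ∀ w ∈ s, T w ∈ s) (v : H) (hv : v ∈ K) : T v ∈ K := by
    refine map_mem_closure T.continuous hv fun w hw => ?_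
    induction hw using Submodule.span_induction with
    | mem w hw => exact Submodule.subset_span (hT w hw)
    | zero => simp
    | add u w _ _ hu hw => rw [map_add]; exact add_mem hu hw
    | smul c w _ hw => rw [map_smul]; exact Submodule.smul_mem _ c hw
  have hsub (v : H) : (b * p) v ∈ K :=
    Submodule.le_topologicalClosure _ (Submodule.subset_span ⟨1, one_mem M, v, rfl⟩)
  have hzero_on (T : H →L[ℂ] H) (hT : ∀ w ∈ s, T w = 0) (v : H) (hv : v ∈ K) : T v = 0 := by
    have : K ≤ T.ker := by
      refine Submodule.topologicalClosure_minimal _ (Submodule.span_le.2 fun w hw => ?_)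
        T.isClosed_ker
      exact hT w hw
    exact this hv
  have : K.HasOrthogonalProjection := by
    have : CompleteSpace K := (Submodule.isClosed_topologicalClosure _).completeSpace_coe
    infer_instance
  have hbpM : b * p ∈ M := mul_mem hb hpM
  have hzM : K.starProjection ∈ M := by
    refine starProjection_mem K fun y hy => hinv y ?_
    rintro _ ⟨y', hy', v, rfl⟩
    refine ⟨y', hy', y v, ?_⟩
    have := congr($((commute_of_mem (mul_mem hy' hbpM) hy).eq) v)
    exact this
  have hzM' : K.starProjection ∈ M.commutant := by
    refine starProjection_mem K fun y hy => hinv y ?_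
    rw [commutant_commutant] at hy
    rintro _ ⟨y', hy', v, rfl⟩
    exact ⟨y * y', mul_mem hy hy', v, rfl⟩
  have hpz : p * K.starProjection = K.starProjection := by
    ext v
    have := hzero_on (1 - p) (by
      rintro _ ⟨y, hy, v, rfl⟩
      have : p * (y * (b * p)) = y * (b * p) := by
        rw [hcen _ (mul_mem hy hbpM), mul_assoc, mul_assoc, hp.2]
      have := congr($this v)
      simp only [mul_apply_eq_comp] at this
      simp [this]) (K.starProjection v) (K.starProjection_apply_mem v)
    exact (sub_eq_zero.1 (by simpa using this)).symm
  have hzp : K.starProjection * p = K.starProjection := by rw [← hcen _ hzM, hpz]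
  obtain ⟨c, hc⟩ := hfac K.starProjection ⟨K.starProjection, hzM, by simp [hpz, hzp]⟩ (by
    rintro _ ⟨y, hy, rfl⟩
    exact (commute_of_mem (mul_mem (mul_mem hpM hy) hpM) hzM').eq.symm)
  have hzb : K.starProjection * (b * p) = b * p := by
    ext v
    exact K.starProjection_eq_self_iff.2 (hsub v)
  have hc1 : c = 1 := by
    rw [hc, smul_mul_assoc, hcen _ hbpM, mul_assoc, hp.2] at hzb
    have : (c - 1) • (b * p) = 0 := by rw [sub_smul, hzb, one_smul, sub_self]
    rcases smul_eq_zero.1 this with h | h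
    · exact sub_eq_zero.1 h
    · exact absurd h hbp
  rw [hc1, one_smul] at hc
  apply hap
  ext v
  refine hzero_on a ?_ (p v) (hc ▸ K.starProjection_apply_mem v)
  rintro _ ⟨y, hy, w, rfl⟩
  have := congr($(hzero y hy) (p w))
  simpa using this

end Operators

open VonNeumannAlgebra
open scoped ComplexStarModule

section Functionals

variable {M : VonNeumannAlgebra H} {f : ↥M →ₗ[ℂ] ℂ}

instance VonNeumannAlgebra.starModule : StarModule ℂ ↥M :=
  ⟨fun c x => Subtype.ext (star_smul c (x : H →L[ℂ] H))⟩

theorem exists_star_mul_self_eq {x : ↥M} (hx : 0 ≤ (x : H →L[ℂ] H)) :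
    ∃ a : ↥M, star a * a = x := by
  have hsa : IsSelfAdjoint (x : H →L[ℂ] H) := .of_nonneg hx
  refine ⟨⟨cfc Real.sqrt (x : H →L[ℂ] H), cfc_mem x.2 hsa _⟩, Subtype.ext ?_⟩
  change star (cfc Real.sqrt (x : H →L[ℂ] H)) * cfc Real.sqrt (x : H →L[ℂ] H) = x
  rw [(cfc_predicate Real.sqrt (x : H →L[ℂ] H) : IsSelfAdjoint _).star_eq, ← cfc_mul _ _ _]
  conv_rhs => rw [← cfc_id' ℝ (x : H →L[ℂ] H)]
  refine cfc_congr fun t ht => ?_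
  exact Real.mul_self_sqrt (spectrum_nonneg_of_nonneg hx ht)

theorem coe_star_mul_self_nonneg (a : ↥M) : 0 ≤ ((star a * a : ↥M) : H →L[ℂ] H) :=
  star_mul_self_nonneg (a : H →L[ℂ] H)

theorem isPosFunctional_iff :
    IsPosFunctional M f ↔ ∀ x : ↥M, 0 ≤ (x : H →L[ℂ] H) → 0 ≤ f x := by
  refine ⟨fun h x hx => ?_, fun h a => h _ (coe_star_mul_self_nonneg a)⟩
  obtain ⟨a, rfl⟩ := exists_star_mul_self_eq hx
  exact h a

namespace IsPosFunctional

theorem nonneg (hf : IsPosFunctional M f) {x : ↥M} (hx : 0 ≤ (x : H →L[ℂ] H)) : 0 ≤ f x :=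
  isPosFunctional_iff.1 hf x hx

theorem map_mono (hf : IsPosFunctional M f) {x y : ↥M}
    (hxy : (x : H →L[ℂ] H) ≤ (y : H →L[ℂ] H)) : f x ≤ f y := by
  have := hf.nonneg (x := y - x) (sub_nonneg.2 hxy)
  rwa [map_sub, sub_nonneg] at this

theorem map_one_nonneg (hf : IsPosFunctional M f) : 0 ≤ f 1 := by
  simpa using hf 1

theorem le_norm_smul {x : ↥M} (hx : IsSelfAdjoint x) :
    (x : H →L[ℂ] H) ≤ ((((‖x‖ : ℝ) : ℂ) • (1 : ↥M) : ↥M) : H →L[ℂ] H) := by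
  have hx' : IsSelfAdjoint (x : H →L[ℂ] H) := congr_arg Subtype.val hx.star_eq
  have := hx'.le_algebraMap_norm_self
  rw [Algebra.algebraMap_eq_smul_one, ← Complex.coe_smul] at this
  exact this

theorem im_eq_zero (hf : IsPosFunctional M f) {x : ↥M} (hx : IsSelfAdjoint x) : (f x).im = 0 := by
  have h1 := hf.map_mono (le_norm_smul hx)
  have h2 := hf.map_one_nonneg
  rw [Complex.le_def] at h1
  rw [Complex.nonneg_iff] at h2
  rw [h1.2, map_smul, smul_eq_mul, Complex.im_ofReal_mul, ← h2.2, mul_zero]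

theorem map_star (hf : IsPosFunctional M f) (x : ↥M) : f (star x) = star (f x) := by
  have h1 := hf.im_eq_zero (ℜ x).2
  have h2 := hf.im_eq_zero (ℑ x).2
  conv_lhs => rw [← realPart_add_I_smul_imaginaryPart x]
  conv_rhs => rw [← realPart_add_I_smul_imaginaryPart x]
  rw [star_add, star_smul, (ℜ x).2.star_eq, (ℑ x).2.star_eq]
  apply Complex.ext <;> simp [h1, h2]

/-- The Cauchy–Schwarz inequality for a positive functional. -/
theorem cauchy_schwarz (hf : IsPosFunctional M f) (x y : ↥M) :
    ‖f (star x * y)‖ ^ 2 ≤ (f (star x * x)).re * (f (star y * y)).re := by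
  have hsym (x y : ↥M) : star (f (star y * x)) = f (star x * y) := by
    rw [← hf.map_star, star_mul, star_star]
  let core : PreInnerProductSpace.Core ℂ ↥M :=
    { inner x y := f (star x * y)
      conj_inner_symm x y := hsym x y
      re_inner_nonneg x := (Complex.nonneg_iff.1 (hf x)).1
      add_left x y z := by simp [add_mul]
      smul_left x y r := by simp }
  have := @InnerProductSpace.Core.inner_mul_inner_self_le ℂ ↥M _ _ _ core x y
  change ‖f (star x * y)‖ * ‖f (star y * x)‖ ≤ _ at this
  rw [← hsym x y, norm_star, ← sq] at *
  exact this

theorem mul_eq_zero_right (hf : IsPosFunctional M f) {y : ↥M} (hy : f (star y * y) = 0) (x : ↥M) :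
    f (x * y) = 0 := by
  have := hf.cauchy_schwarz (star x) y
  rw [hy, star_star, Complex.zero_re, mul_zero] at this
  exact norm_eq_zero.1 (pow_eq_zero_iff two_ne_zero |>.1 (le_antisymm this (sq_nonneg _)))

theorem mul_eq_zero_left (hf : IsPosFunctional M f) {y : ↥M} (hy : f (y * star y) = 0) (x : ↥M) :
    f (y * x) = 0 := by
  have := hf.mul_eq_zero_right (y := star y) (by rwa [star_star]) (star x)
  rwa [← star_mul, hf.map_star, star_eq_zero] at this

theorem norm_le (hf : IsPosFunctional M f) (x : ↥M) : ‖f x‖ ≤ (f 1).re * ‖x‖ := by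
  have h0 : 0 ≤ (f 1).re := (Complex.nonneg_iff.1 hf.map_one_nonneg).1
  have h1 := hf.cauchy_schwarz 1 x
  have h2 := (Complex.le_def.1 (hf.map_mono (le_norm_smul (IsSelfAdjoint.star_mul_self x)))).1
  have h3 : ‖star x * x‖ = ‖x‖ * ‖x‖ := CStarRing.norm_star_mul_self (x := (x : H →L[ℂ] H))
  rw [map_smul, smul_eq_mul, Complex.re_ofReal_mul, h3] at h2
  simp only [star_one, one_mul] at h1
  refine abs_le_of_sq_le_sq' ?_ (by positivity) |>.2
  calc ‖f x‖ ^ 2 ≤ (f 1).re * (f (star x * x)).re := h1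
    _ ≤ (f 1).re * (‖x‖ * ‖x‖ * (f 1).re) := by gcongr
    _ = _ := by ring

theorem continuous (hf : IsPosFunctional M f) : Continuous f :=
  AddMonoidHomClass.continuous_of_bound f (f 1).re hf.norm_le

end IsPosFunctional

theorem continuous_sigmaWeak_inner (v w : H) :
    @Continuous _ _ (sigmaWeak H) _ (fun x : H →L[ℂ] H => ⟪v, x w⟫_ℂ) := by
  have key (u : H) : Summable fun n => ‖(Pi.single 0 u : ℕ → H) n‖ ^ 2 :=
    summable_of_ne_finset_zero (s := {0}) fun n hn => by
      rw [Finset.mem_singleton] at hn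
      simp [hn]
  have : (fun x : H →L[ℂ] H => ⟪v, x w⟫_ℂ) = fun x : H →L[ℂ] H =>
      ∑' n, ⟪(Pi.single 0 v : ℕ → H) n, x ((Pi.single 0 w : ℕ → H) n)⟫_ℂ := by
    funext x
    rw [tsum_eq_single 0 fun n hn => by simp [hn]]
    simp
  rw [this, continuous_iff_le_induced]
  exact iInf_le_of_le _ (iInf_le_of_le _ (iInf_le_of_le (key v) (iInf_le_of_le (key w) le_rfl)))

theorem isNormalOn_of_forall_eq {f : ↥M →ₗ[ℂ] ℂ} {ι : Type*} (s : Finset ι) (c : ι → ℂ)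
    (v w : ι → H) (h : ∀ x : ↥M, f x = ∑ i ∈ s, c i * ⟪v i, (x : H →L[ℂ] H) (w i)⟫_ℂ) :
    IsNormalOn M f := by
  have : (f : ↥M → ℂ) = (fun x : H →L[ℂ] H => ∑ i ∈ s, c i * ⟪v i, x (w i)⟫_ℂ) ∘
      (fun x : ↥M => (x : H →L[ℂ] H)) := funext h
  unfold IsNormalOn
  rw [this]
  let _ := sigmaWeak H
  refine Continuous.comp ?_ continuous_induced_dom
  exact continuous_finsetSum _ fun i _ => (continuous_sigmaWeak_inner (v i) (w i)).const_mul _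

/-- A bounded sequence converging strongly to zero converges to zero σ-weakly. -/
theorem tendsto_sigmaWeak_zero {x : ℕ → H →L[ℂ] H} (hb : ∀ n, ‖x n‖ ≤ 1)
    (hx : ∀ v, Tendsto (fun n => x n v) atTop (𝓝 0)) :
    Tendsto x atTop (@nhds _ (sigmaWeak H) 0) := by
  rw [sigmaWeak]
  simp only [nhds_iInf, nhds_induced, tendsto_iInf, tendsto_comap_iff]
  intro ξ η hξ hη
  have : (∑' n, ⟪ξ n, (0 : H →L[ℂ] H) (η n)⟫_ℂ) = ∑' n : ℕ, (0 : ℂ) := by simp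
  rw [this]
  refine tendsto_tsum_of_dominated_convergence (bound := fun n => ‖ξ n‖ ^ 2 + ‖η n‖ ^ 2)
    (hξ.add hη) (fun k => ?_) (.of_forall fun n k => ?_)
  · simpa using (tendsto_const_nhds (x := ξ k)).inner (𝕜 := ℂ) (hx (η k))
  · refine (norm_inner_le_norm _ _).trans ?_
    have h1 : ‖x n (η k)‖ ≤ ‖η k‖ := by
      simpa using (x n).le_of_opNorm_le (hb n) (η k)
    nlinarith [norm_nonneg (ξ k), norm_nonneg (η k), sq_nonneg (‖ξ k‖ - ‖η k‖)]

end Functionals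

section Dichotomy

/-- A decreasing sequence of projections converging strongly to zero. -/
structure IsVanishing (Q : ℕ → H →L[ℂ] H) : Prop where
  isProjection : ∀ n, IsProjection (Q n)
  mul_of_le : ∀ m n, m ≤ n → Q m * Q n = Q n
  tendsto : ∀ v, Tendsto (fun n => Q n v) atTop (𝓝 0)

theorem IsVanishing.mul_of_le' {Q : ℕ → H →L[ℂ] H} (hQ : IsVanishing Q) {m n : ℕ} (h : m ≤ n) :
    Q n * Q m = Q n := by
  have := congr_arg star (hQ.mul_of_le m n h)
  rwa [star_mul, (hQ.isProjection n).1, (hQ.isProjection m).1] at this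

theorem apply_eq_zero_of_re_inner {x : H →L[ℂ] H} (hx : 0 ≤ x) {v : H}
    (hv : (⟪v, x v⟫_ℂ).re ≤ 0) : x v = 0 := by
  obtain ⟨a, rfl⟩ := CStarAlgebra.nonneg_iff_eq_star_mul_self.1 hx
  have h : a v = 0 := by
    rw [mul_apply_eq_comp, ContinuousLinearMap.star_eq_adjoint,
      ContinuousLinearMap.adjoint_inner_right] at hv
    have h2 : (⟪a v, a v⟫_ℂ).re = ‖a v‖ ^ 2 := inner_self_eq_norm_sq (𝕜 := ℂ) (a v)
    rw [h2] at hv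
    exact norm_eq_zero.1 (pow_eq_zero_iff two_ne_zero |>.1 (le_antisymm hv (sq_nonneg _)))
  rw [mul_apply_eq_comp, h, map_zero]

theorem re_inner_self (v : H) : (⟪v, v⟫_ℂ).re = ‖v‖ ^ 2 :=
  inner_self_eq_norm_sq (𝕜 := ℂ) v

theorem re_inner_real_smul (r : ℝ) (v w : H) : (⟪v, r • w⟫_ℂ).re = r * (⟪v, w⟫_ℂ).re := by
  rw [← Complex.coe_smul, inner_smul_right, Complex.re_ofReal_mul]

theorem IsProjection.le_smul_conj {R y : H →L[ℂ] H} (hR : IsProjection R) (hsa : IsSelfAdjoint y)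
    {c : ℝ} (h : ∀ v, ‖R v‖ ^ 2 ≤ c * (⟪R v, y (R v)⟫_ℂ).re) : R ≤ c • (R * y * R) := by
  have hsa' : IsSelfAdjoint (R * y * R) := by
    have := hsa.conjugate R
    rwa [hR.1] at this
  rw [← sub_nonneg, nonneg_iff_re_inner (((IsSelfAdjoint.all c).smul hsa').sub hR.1)]
  intro v
  rw [_root_.sub_apply, inner_sub_right, _root_.smul_apply, Complex.sub_re, re_inner_real_smul,
    hR.re_inner, mul_apply_eq_comp, mul_apply_eq_comp, ← hR.isSelfAdjoint.inner_left, sub_nonneg]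
  exact h v

theorem isVanishing_of_forall_eq_zero {Q : ℕ → H →L[ℂ] H} (hp : ∀ n, IsProjection (Q n))
    (hle : ∀ m n, m ≤ n → Q m * Q n = Q n) (h0 : ∀ v, (∀ n, Q n v = v) → v = 0) :
    IsVanishing Q := by
  refine ⟨hp, hle, ?_⟩
  have hle' {m n : ℕ} (h : m ≤ n) : Q n * Q m = Q n := by
    have := congr_arg star (hle m n h)
    rwa [star_mul, (hp n).1, (hp m).1] at this
  let S : Submodule ℂ H :=
    { carrier := {v | Tendsto (fun n => Q n v) atTop (𝓝 0)}
      zero_mem' := by simp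
      add_mem' := fun {v w} hv hw => by simpa using Tendsto.add hv hw
      smul_mem' := fun c v hv => by simpa using Tendsto.const_smul hv c }
  have hcl : IsClosed (S : Set H) := by
    refine isClosed_of_closure_subset fun v hv => ?_
    refine Metric.tendsto_atTop.2 fun ε hε => ?_
    obtain ⟨w, hw, hvw⟩ := Metric.mem_closure_iff.1 hv (ε / 2) (half_pos hε)
    obtain ⟨N, hN⟩ := Metric.tendsto_atTop.1 hw (ε / 2) (half_pos hε)
    refine ⟨N, fun n hn => ?_⟩
    have h1 := hN n hn
    rw [dist_zero_right] at h1 ⊢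
    have h2 : Q n v = Q n (v - w) + Q n w := by simp
    have h3 := (hp n).norm_apply_le (v - w)
    rw [dist_eq_norm] at hvw
    rw [h2]
    linarith [norm_add_le (Q n (v - w)) (Q n w)]
  have hS : S = ⊤ := by
    have : CompleteSpace S := hcl.completeSpace_coe
    rw [← Submodule.orthogonal_eq_bot_iff, Submodule.eq_bot_iff]
    refine fun v hv => h0 v fun n => ?_
    have hmem : v - Q n v ∈ S := by
      refine tendsto_const_nhds.congr' ?_
      filter_upwards [eventually_ge_atTop n] with m hm
      have := congr($(hle' hm) v)
      rw [mul_apply_eq_comp] at this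
      simp [this]
    have h1 := hv _ hmem
    have h2 : ⟪v - Q n v, Q n v⟫_ℂ = 0 := by
      rw [← (hp n).isSelfAdjoint.inner_left, map_sub, (hp n).apply_apply, sub_self,
        inner_zero_left]
    have h3 : ⟪v - Q n v, v - Q n v⟫_ℂ = 0 := by rw [inner_sub_right, h1, h2, sub_zero]
    exact (sub_eq_zero.1 (inner_self_eq_zero.1 h3)).symm
  exact fun v => (hS ▸ Submodule.mem_top : v ∈ S)

/-- An injective positive operator `y ∈ C` yields projections in `C` decreasing to zero whose
complements are dominated by multiples of `y`. -/
theorem exists_isVanishing_of_ker_eq_bot {C : VonNeumannAlgebra H} {y : H →L[ℂ] H} (hy : y ∈ C)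
    (hpos : 0 ≤ y) (hker : ∀ v, y v = 0 → v = 0) :
    ∃ Q : ℕ → H →L[ℂ] H, IsVanishing Q ∧ (∀ n, Q n ∈ C) ∧
      ∀ n : ℕ, 1 - Q n ≤ ((n : ℝ) + 1) • ((1 - Q n) * y * (1 - Q n)) := by
  have hsa : IsSelfAdjoint y := .of_nonneg hpos
  let g (n : ℕ) (t : ℝ) : ℝ := max (t - 1 / ((n : ℝ) + 1)) 0
  have hg (n : ℕ) : Continuous (g n) := by fun_prop
  let a (n : ℕ) : H →L[ℂ] H := cfc (g n) y
  have ha0 (n : ℕ) : 0 ≤ a n := cfc_nonneg fun t _ => le_max_right _ _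
  have haC (n : ℕ) : a n ∈ C := cfc_mem hy hsa _
  have hamono {m n : ℕ} (h : m ≤ n) : a m ≤ a n :=
    cfc_mono (hf := (hg m).continuousOn) (hg := (hg n).continuousOn) fun t _ => by
      dsimp only [g]; gcongr
  have hker' {m n : ℕ} (h : m ≤ n) (v : H) (hv : a n v = 0) : a m v = 0 := by
    refine apply_eq_zero_of_re_inner (ha0 m) ((re_inner_mono (hamono h) v).trans ?_)
    simp [hv]
  let K (n : ℕ) : Submodule ℂ H := (a n).ker
  have hK (n : ℕ) : CompleteSpace (K n) := (a n).isClosed_ker.completeSpace_coe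
  have hQp (n : ℕ) : IsProjection (K n).starProjection := isProjection_starProjection _
  refine ⟨fun n => (K n).starProjection, isVanishing_of_forall_eq_zero hQp (fun m n h => ?_)
    (fun v hv => ?_), fun n => ?_, fun n => ?_⟩
  · ext v
    refine (K m).starProjection_eq_self_iff.2 (hker' h _ ?_)
    exact (K n).starProjection_apply_mem v
  · have hle (n : ℕ) : (⟪v, y v⟫_ℂ).re ≤ (1 / ((n : ℝ) + 1)) * ‖v‖ ^ 2 := by
      have h1 : a n v = 0 := (K n).starProjection_eq_self_iff.1 (hv n)
      have h2 : y ≤ (1 / ((n : ℝ) + 1)) • 1 + a n := by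
        rw [← Algebra.algebraMap_eq_smul_one, ← cfc_const_add _ (g n) y (hg n).continuousOn]
        conv_lhs => rw [← cfc_id' ℝ y]
        refine cfc_mono (hg := by fun_prop) fun t _ => ?_
        have := le_max_left (t - 1 / ((n : ℝ) + 1)) 0
        dsimp only [g]
        linarith
      have h3 := re_inner_mono h2 v
      rw [_root_.add_apply, h1, add_zero] at h3
      refine h3.trans_eq ?_
      rw [_root_.smul_apply, one_apply_eq_self, re_inner_real_smul, re_inner_self]
    refine hker v (apply_eq_zero_of_re_inner hpos ?_)
    refine ge_of_tendsto' (x := atTop) ?_ hle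
    simpa using tendsto_one_div_add_atTop_nhds_zero_nat.mul_const (‖v‖ ^ 2)
  · refine starProjection_mem _ fun z hz v hv => ?_
    have := congr($((commute_of_mem (haC n) hz).eq) v)
    change a n (z v) = z (a n v) at this
    change a n (z v) = 0
    rw [this, show a n v = 0 from hv, map_zero]
  · have hpos' : (0 : ℝ) < (n : ℝ) + 1 := by positivity
    have hcomm : cfc (g n) y * (y - (1 / ((n : ℝ) + 1)) • 1) * cfc (g n) y =
        cfc (fun t => g n t * (t - 1 / ((n : ℝ) + 1)) * g n t) y := by
      rw [cfc_mul (fun t => g n t * (t - 1 / ((n : ℝ) + 1))) (g n) y (by fun_prop)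
        (hg n).continuousOn, cfc_mul (g n) _ y (hg n).continuousOn (by fun_prop),
        cfc_sub _ _ y, cfc_id' ℝ y, cfc_const _ y, Algebra.algebraMap_eq_smul_one]
    have hcl (v : H) (hv : v ∈ (K n)ᗮ) : (1 / ((n : ℝ) + 1)) * ‖v‖ ^ 2 ≤ (⟪v, y v⟫_ℂ).re := by
      have hrange : (K n)ᗮ = (a n).range.topologicalClosure := by
        have := (a n).orthogonal_ker
        rwa [(IsSelfAdjoint.of_nonneg (ha0 n)).adjoint_eq] at this
      rw [hrange] at hv
      have hclosed : IsClosed {v : H | (1 / ((n : ℝ) + 1)) * ‖v‖ ^ 2 ≤ (⟪v, y v⟫_ℂ).re} :=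
        isClosed_le (by fun_prop) (by fun_prop)
      refine closure_minimal (s := ((a n).range : Set H)) ?_ hclosed hv
      rintro _ ⟨w, rfl⟩
      have h0 : 0 ≤ a n * (y - (1 / ((n : ℝ) + 1)) • 1) * a n := by
        rw [hcomm]
        refine cfc_nonneg fun t _ => ?_
        rcases le_total (t - 1 / ((n : ℝ) + 1)) 0 with h | h
        · simp [show g n t = 0 from max_eq_right h]
        · have : 0 ≤ g n t := le_max_right _ _
          positivity
      have h1 := re_inner_nonneg h0 w
      rw [mul_apply_eq_comp, mul_apply_eq_comp,
        ← (IsSelfAdjoint.of_nonneg (ha0 n)).inner_left, _root_.sub_apply,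
        inner_sub_right, _root_.smul_apply, one_apply_eq_self,
        Complex.sub_re, re_inner_real_smul, re_inner_self] at h1
      simpa using h1
    have hRv (v : H) : (1 - (K n).starProjection) v ∈ (K n)ᗮ :=
      (K n).sub_starProjection_mem_orthogonal v
    refine (hQp n).one_sub.le_smul_conj hsa fun v => ?_
    calc _ = ((n : ℝ) + 1) * ((1 / ((n : ℝ) + 1)) * ‖(1 - (K n).starProjection) v‖ ^ 2) := by
          field_simp
      _ ≤ _ := by gcongr; exact hcl _ (hRv v)

end Dichotomy

section Characters

variable {M : VonNeumannAlgebra H} {f : ↥M →ₗ[ℂ] ℂ}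

/-- Countably many operators of `C` in the kernel of a state can be replaced by a single positive
one with the same joint kernel. -/
theorem exists_nonneg_ker_le {C : VonNeumannAlgebra H} (hC : (C : Set (H →L[ℂ] H)) ⊆ M)
    (hf : IsPosFunctional M f) (z : ℕ → ↥M) (hzC : ∀ i, (z i : H →L[ℂ] H) ∈ C)
    (hz : ∀ i, f (star (z i) * z i) = 0) :
    ∃ y : ↥M, (y : H →L[ℂ] H) ∈ C ∧ 0 ≤ (y : H →L[ℂ] H) ∧ f y = 0 ∧
      ∀ v, (y : H →L[ℂ] H) v = 0 → ∀ i, (z i : H →L[ℂ] H) v = 0 := by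
  let b (i : ℕ) : ↥M := star (z i) * z i
  let c (i : ℕ) : ℝ := (1 / 2) ^ i / (1 + ‖b i‖)
  have hc (i : ℕ) : 0 < c i := by positivity
  let t (i : ℕ) : ↥M := (c i : ℂ) • b i
  have htn (i : ℕ) : ‖(t i : H →L[ℂ] H)‖ ≤ (1 / 2) ^ i := by
    have : ‖(t i : H →L[ℂ] H)‖ = c i * ‖b i‖ := by
      change ‖(c i : ℂ) • (b i : H →L[ℂ] H)‖ = _
      rw [norm_smul, Complex.norm_real, Real.norm_of_nonneg (hc i).le]
      rfl
    rw [this, div_mul_eq_mul_div, div_le_iff₀ (by positivity)]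
    have : (0 : ℝ) < (1 / 2) ^ i := by positivity
    nlinarith
  have hsum : Summable fun i => (t i : H →L[ℂ] H) :=
    .of_norm_bounded (summable_geometric_of_lt_one (by norm_num) (by norm_num)) htn
  obtain ⟨y, hy⟩ := hsum
  have htC (i : ℕ) : (t i : H →L[ℂ] H) ∈ C :=
    SMulMemClass.smul_mem (c i : ℂ) (mul_mem (star_mem (hzC i)) (hzC i))
  have hyv (v : H) : HasSum (fun i => (t i : H →L[ℂ] H) v) (y v) :=
    hy.mapL (ContinuousLinearMap.apply ℂ H v)
  have hyC : y ∈ C := by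
    refine mem_of_tendsto (x := fun n => ∑ i ∈ Finset.range n, (t i : H →L[ℂ] H))
      (fun n => sum_mem fun i _ => htC i) fun v => ?_
    simpa using (hyv v).tendsto_sum_nat
  have hre (v : H) : HasSum (fun i => c i * ‖(z i : H →L[ℂ] H) v‖ ^ 2) (⟪v, y v⟫_ℂ).re := by
    have h1 := ((hyv v).mapL (innerSL ℂ v)).mapL Complex.reCLM
    refine h1.congr_fun fun i => ?_
    change _ = (⟪v, (c i : ℂ) • (star (z i : H →L[ℂ] H) * (z i : H →L[ℂ] H)) v⟫_ℂ).re
    rw [inner_smul_right, Complex.re_ofReal_mul, mul_apply_eq_comp,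
      ContinuousLinearMap.star_eq_adjoint, ContinuousLinearMap.adjoint_inner_right, re_inner_self]
  have ht0 (i : ℕ) : 0 ≤ (t i : H →L[ℂ] H) := by
    change 0 ≤ (c i : ℂ) • (star (z i : H →L[ℂ] H) * (z i : H →L[ℂ] H))
    rw [Complex.coe_smul]
    exact smul_nonneg (hc i).le (star_mul_self_nonneg _)
  refine ⟨⟨y, hC hyC⟩, hyC, hy.nonneg ht0, ?_, fun v hv i => ?_⟩
  · have h1 : HasSum t (⟨y, hC hyC⟩ : ↥M) := by
      have hind : IsInducing (AddSubmonoidClass.subtype M) := IsInducing.subtypeVal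
      exact (hind.hasSum_iff t _).1 hy
    have h2 := h1.map f hf.continuous
    have h3 : f ∘ t = fun _ => 0 := by
      funext i
      simp only [Function.comp_apply, t, b, map_smul, hz, smul_zero]
    rw [h3] at h2
    exact h2.unique hasSum_zero
  · have h1 := hre v
    rw [show y v = 0 from hv, inner_zero_right, Complex.zero_re,
      hasSum_zero_iff_of_nonneg fun i => by have := hc i; positivity] at h1
    have h2 := congr_fun h1 i
    simpa [(hc i).ne'] using h2

/-- A state that is multiplicative on `C` is given on `C` by a joint eigenvector, or it takes the
value one along projections of `C` decreasing to zero. -/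
theorem exists_eigenvector_or_isVanishing [TopologicalSpace.SeparableSpace H]
    {C : VonNeumannAlgebra H} (hC : (C : Set (H →L[ℂ] H)) ⊆ M) (hf : IsStateOn M f)
    (hmul : IsMultiplicativeOn M f (C : Set (H →L[ℂ] H))) :
    (∃ v : H, ‖v‖ = 1 ∧ ∀ z : ↥M, (z : H →L[ℂ] H) ∈ C → (z : H →L[ℂ] H) v = f z • v) ∨
      ∃ Q : ℕ → ↥M, (∀ n, (Q n : H →L[ℂ] H) ∈ C) ∧
        IsVanishing (fun n => (Q n : H →L[ℂ] H)) ∧ ∀ n, f (Q n) = 1 := by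
  have hsec : SecondCountableTopology H := UniformSpace.secondCountable_of_separable H
  by_cases hK : ∃ v : H, v ≠ 0 ∧ ∀ z : ↥M, (z : H →L[ℂ] H) ∈ C → f z = 0 → (z : H →L[ℂ] H) v = 0
  · left
    obtain ⟨v, hv0, hv⟩ := hK
    refine ⟨((‖v‖⁻¹ : ℝ) : ℂ) • v, ?_, fun z hz => ?_⟩
    · rw [norm_smul, Complex.norm_real, norm_inv, norm_norm, inv_mul_cancel₀ (norm_ne_zero_iff.2 hv0)]
    · have h1 := hv (z - f z • 1) (sub_mem hz (SMulMemClass.smul_mem _ (one_mem C)))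
        (by rw [map_sub, map_smul, hf.2, smul_eq_mul, mul_one, sub_self])
      have h2 : (z : H →L[ℂ] H) v = f z • v := sub_eq_zero.1 h1
      rw [map_smul, h2, smul_comm]
  right
  push Not at hK
  let N := {z : ↥M // (z : H →L[ℂ] H) ∈ C ∧ f z = 0}
  obtain ⟨T, hT, hTeq⟩ := TopologicalSpace.isOpen_iUnion_countable
    (fun z : N => {v : H | ((z : ↥M) : H →L[ℂ] H) v ≠ 0})
    fun z => isOpen_ne_fun (by fun_prop) (by fun_prop)
  let zero : N := ⟨0, zero_mem C, map_zero f⟩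
  obtain ⟨z, hz⟩ := (hT.insert zero).exists_eq_range ⟨_, Set.mem_insert _ _⟩
  obtain ⟨y, hyC, hy0, hfy, hyker⟩ := exists_nonneg_ker_le hC hf.1 (fun i => (z i).1)
    (fun i => (z i).2.1) (fun i => by
      rw [hmul _ _ (star_mem (z i).2.1) (z i).2.1, (z i).2.2, mul_zero])
  have hker (v : H) (hv : (y : H →L[ℂ] H) v = 0) : v = 0 := by
    by_contra hv0
    obtain ⟨w, hwC, hw, hwv⟩ := hK v hv0
    have h1 : v ∈ ⋃ z : N, {v : H | ((z : ↥M) : H →L[ℂ] H) v ≠ 0} :=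
      Set.mem_iUnion.2 ⟨⟨w, hwC, hw⟩, hwv⟩
    rw [← hTeq] at h1
    obtain ⟨u, huT, hu⟩ := Set.mem_iUnion₂.1 h1
    obtain ⟨i, rfl⟩ : u ∈ Set.range z := hz ▸ Set.mem_insert_of_mem _ huT
    exact hu (hyker v hv i)
  obtain ⟨Q, hQ, hQC, hQy⟩ := exists_isVanishing_of_ker_eq_bot hyC hy0 hker
  refine ⟨fun n => ⟨Q n, hC (hQC n)⟩, hQC, hQ, fun n => ?_⟩
  let R : ↥M := 1 - ⟨Q n, hC (hQC n)⟩
  have hRC : (R : H →L[ℂ] H) ∈ C := sub_mem (one_mem C) (hQC n)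
  have h1 : f R ≤ f ((((n : ℝ) + 1 : ℝ) : ℂ) • (R * y * R)) := hf.1.map_mono (hQy n)
  rw [map_smul, hmul _ _ (mul_mem hRC hyC) hRC, hmul _ _ hRC hyC, hfy, mul_zero, zero_mul,
    smul_zero] at h1
  have h2 : 0 ≤ f R := hf.1.nonneg (hQ.isProjection n).one_sub.nonneg
  have h3 : f R = 0 := le_antisymm h1 h2
  rw [map_sub, hf.2, sub_eq_zero] at h3
  exact h3.symm

theorem isNormalOnSub_of_eigenvector {C : VonNeumannAlgebra H}
    (hC : (C : Set (H →L[ℂ] H)) ⊆ M) {v : H} (hv1 : ‖v‖ = 1)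
    (hv : ∀ z : ↥M, (z : H →L[ℂ] H) ∈ C → (z : H →L[ℂ] H) v = f z • v) :
    IsNormalOnSub M f C hC := by
  have : (fun x : ↥C => f ⟨x, hC x.2⟩) = (fun x : H →L[ℂ] H => ⟪v, x v⟫_ℂ) ∘
      (fun x : ↥C => (x : H →L[ℂ] H)) := by
    funext x
    have h1 := hv ⟨x, hC x.2⟩ x.2
    change (x : H →L[ℂ] H) v = _ at h1
    rw [Function.comp_apply, h1, inner_smul_right, inner_self_eq_norm_sq_to_K, hv1]
    simp
  unfold IsNormalOnSub
  rw [this]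
  let _ := sigmaWeak H
  exact (continuous_sigmaWeak_inner v v).comp continuous_induced_dom

theorem IsVanishing.norm_le_one {Q : ℕ → H →L[ℂ] H} (hQ : IsVanishing Q) (n : ℕ) : ‖Q n‖ ≤ 1 :=
  (Q n).opNorm_le_bound zero_le_one fun v => by
    simpa using (hQ.isProjection n).norm_apply_le v

theorem not_isNormalOnSub_of_isVanishing {C : VonNeumannAlgebra H}
    (hC : (C : Set (H →L[ℂ] H)) ⊆ M) {Q : ℕ → ↥M} (hQC : ∀ n, (Q n : H →L[ℂ] H) ∈ C)
    (hQ : IsVanishing (fun n => (Q n : H →L[ℂ] H))) (hfQ : ∀ n, f (Q n) = 1) :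
    ¬ IsNormalOnSub M f C hC := by
  intro h
  let _ : TopologicalSpace (H →L[ℂ] H) := sigmaWeak H
  have h1 : Tendsto (fun n => (⟨Q n, hQC n⟩ : ↥C)) atTop
      (@nhds _ (TopologicalSpace.induced (fun x : ↥C => (x : H →L[ℂ] H)) (sigmaWeak H)) 0) := by
    rw [nhds_induced, tendsto_comap_iff]
    exact tendsto_sigmaWeak_zero hQ.norm_le_one hQ.tendsto
  have h2 := ((@Continuous.tendsto _ _ (_) _ _ h 0).comp h1)
  have h3 : (fun x : ↥C => f ⟨x, hC x.2⟩) ∘ (fun n => (⟨Q n, hQC n⟩ : ↥C)) = fun _ => 1 :=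
    funext hfQ
  rw [h3] at h2
  have h4 : f ⟨((0 : ↥C) : H →L[ℂ] H), hC (0 : ↥C).2⟩ = 0 := map_zero f
  rw [h4] at h2
  exact one_ne_zero (tendsto_nhds_unique tendsto_const_nhds h2)

theorem not_isNormalOn_of_isVanishing {Q : ℕ → ↥M}
    (hQ : IsVanishing (fun n => (Q n : H →L[ℂ] H))) (hfQ : ∀ n, f (Q n) = 1) :
    ¬ IsNormalOn M f :=
  not_isNormalOnSub_of_isVanishing (f := f) subset_rfl (fun n => (Q n).2) hQ hfQ

end Characters

section Necessity

/-- The center of a von Neumann algebra. -/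
noncomputable def VonNeumannAlgebra.center (M : VonNeumannAlgebra H) : VonNeumannAlgebra H where
  toStarSubalgebra := M.toStarSubalgebra ⊓ M.commutant.toStarSubalgebra
  centralizer_centralizer' := by
    refine subset_antisymm (fun x hx => ?_) Set.subset_centralizer_centralizer
    refine ⟨?_, ?_⟩
    · refine mem_of_forall_commute fun y hy => (hx y ?_).symm
      exact fun z hz => commute_of_mem hz.1 hy
    · refine mem_commutant_iff.2 fun y hy => hx y ?_
      exact fun z hz => (commute_of_mem hy hz.2).eq.symm

variable {M : VonNeumannAlgebra H} {f : ↥M →ₗ[ℂ] ℂ}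

theorem VonNeumannAlgebra.center_subset : (M.center : Set (H →L[ℂ] H)) ⊆ M := fun _ hx => hx.1

theorem VonNeumannAlgebra.mul_comm_of_mem_center {z : ↥M} (hz : (z : H →L[ℂ] H) ∈ M.center)
    (x : ↥M) : z * x = x * z :=
  Subtype.ext (commute_of_mem x.2 hz.2).eq.symm

theorem isPosFunctional_mul_left (hf : IsPosFunctional M f) {z : ↥M}
    (hz : (z : H →L[ℂ] H) ∈ M.center) (h0 : 0 ≤ (z : H →L[ℂ] H)) :
    IsPosFunctional M (f ∘ₗ LinearMap.mulLeft ℂ z) := by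
  intro a
  change 0 ≤ f (z * (star a * a))
  rw [← mul_assoc, mul_comm_of_mem_center hz]
  obtain ⟨b, rfl⟩ := exists_star_mul_self_eq h0
  have : star a * (star b * b) * a = star (b * a) * (b * a) := by
    rw [star_mul]; simp only [mul_assoc]
  rw [this]
  exact hf _

theorem IsPureStateOn.map_mul_of_nonneg (hf : IsPureStateOn M f) {z : ↥M}
    (hz : (z : H →L[ℂ] H) ∈ M.center) (h0 : 0 ≤ (z : H →L[ℂ] H)) (x : ↥M) :
    f (z * x) = f z * f x := by
  let c : ℝ := (‖z‖ + 1)⁻¹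
  have hc : 0 < c := by positivity
  let z' : ↥M := (c : ℂ) • z
  have hz' : (z' : H →L[ℂ] H) ∈ M.center := SMulMemClass.smul_mem (c : ℂ) hz
  have hz'0 : 0 ≤ (z' : H →L[ℂ] H) := by
    change 0 ≤ (c : ℂ) • (z : H →L[ℂ] H)
    rw [Complex.coe_smul]
    exact smul_nonneg hc.le h0
  have hz'1 : 0 ≤ ((1 - z' : ↥M) : H →L[ℂ] H) := by
    have hsa : IsSelfAdjoint (z : H →L[ℂ] H) := .of_nonneg h0
    change 0 ≤ 1 - (c : ℂ) • (z : H →L[ℂ] H)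
    rw [Complex.coe_smul, sub_nonneg]
    have h1 := smul_le_smul_of_nonneg_left (hsa.le_algebraMap_norm_self) hc.le
    refine h1.trans ?_
    rw [Algebra.algebraMap_eq_smul_one, smul_smul]
    have h2 : c * ‖(z : H →L[ℂ] H)‖ ≤ 1 := by
      change (‖z‖ + 1)⁻¹ * ‖z‖ ≤ 1
      rw [inv_mul_le_iff₀ (by positivity)]
      linarith
    calc _ ≤ (1 : ℝ) • (1 : H →L[ℂ] H) := smul_le_smul_of_nonneg_right h2 zero_le_one
      _ = 1 := one_smul _ _
  have hsub : f - f ∘ₗ LinearMap.mulLeft ℂ z' = f ∘ₗ LinearMap.mulLeft ℂ (1 - z') := by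
    ext a
    simp [sub_mul]
  obtain ⟨t, -, ht⟩ := hf.2 _ (isPosFunctional_mul_left hf.1.1 hz' hz'0) (by
    rw [hsub]
    exact isPosFunctional_mul_left hf.1.1 (sub_mem (one_mem _) hz') hz'1)
  have h1 (x : ↥M) : c * f (z * x) = t * f x := by
    have := congr($ht x)
    simpa [z'] using this
  have h2 := h1 1
  rw [mul_one, hf.1.2, mul_one] at h2
  have hc' : (c : ℂ) ≠ 0 := Complex.ofReal_ne_zero.2 hc.ne'
  refine mul_left_cancel₀ hc' ?_
  rw [h1, ← h2, mul_assoc]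

theorem IsPureStateOn.map_mul_of_mem_center (hf : IsPureStateOn M f) {z : ↥M}
    (hz : (z : H →L[ℂ] H) ∈ M.center) (x : ↥M) : f (z * x) = f z * f x := by
  have hsa (w : ↥M) (hw : (w : H →L[ℂ] H) ∈ M.center) (hwsa : IsSelfAdjoint w) :
      f (w * x) = f w * f x := by
    have h1 := hf.map_mul_of_nonneg (z := ((‖w‖ : ℝ) : ℂ) • 1 - w)
      (sub_mem (SMulMemClass.smul_mem _ (one_mem _)) hw)
      (sub_nonneg.2 (IsPosFunctional.le_norm_smul hwsa)) x
    simp only [sub_mul, map_sub, smul_mul_assoc, one_mul, map_smul, hf.1.2, smul_eq_mul,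
      mul_one] at h1
    linear_combination -h1
  have hre : ((ℜ z : ↥M) : H →L[ℂ] H) ∈ M.center := by
    rw [realPart_apply_coe]
    exact VonNeumannAlgebra.real_smul_mem (add_mem hz (star_mem hz)) _
  have him : ((ℑ z : ↥M) : H →L[ℂ] H) ∈ M.center := by
    rw [imaginaryPart_apply_coe]
    exact SMulMemClass.smul_mem (-Complex.I)
      (VonNeumannAlgebra.real_smul_mem (sub_mem hz (star_mem hz)) _)
  rw [← realPart_add_I_smul_imaginaryPart z]
  simp only [add_mul, map_add, smul_mul_assoc, map_smul, hsa _ hre (ℜ z).2, hsa _ him (ℑ z).2,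
    smul_eq_mul]
  ring

theorem IsStateOn.map_corner (hf : IsStateOn M f) {p : ↥M} (hp : IsProjection (p : H →L[ℂ] H))
    (hfp : f p = 1) (x : ↥M) : f (p * x * p) = f x := by
  have hs : star (1 - p) = 1 - p := Subtype.ext hp.one_sub.1
  have h0 : (1 - p) * (1 - p) = 1 - p := Subtype.ext hp.one_sub.2
  have h1 : f ((1 - p) * x) = 0 :=
    hf.1.mul_eq_zero_left (by rw [hs, h0, map_sub, hf.2, hfp, sub_self]) x
  have h2 : f (p * x * (1 - p)) = 0 :=
    hf.1.mul_eq_zero_right (by rw [hs, h0, map_sub, hf.2, hfp, sub_self]) _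
  have h3 : x = (1 - p) * x + p * x * (1 - p) + p * x * p := by noncomm_ring
  conv_rhs => rw [h3, map_add, map_add, h1, h2, zero_add, zero_add]

theorem span_corner_le {p : H →L[ℂ] H} (hp : p ∈ M) {x : H →L[ℂ] H}
    (hx : x ∈ Submodule.span ℂ (corner M p)) : x ∈ M := by
  induction hx using Submodule.span_induction with
  | mem x hx =>
    obtain ⟨y, hy, rfl⟩ := hx
    exact mul_mem (mul_mem hp hy) hp
  | zero => exact zero_mem M
  | add x y _ _ hx hy => exact add_mem hx hy
  | smul c x _ hx => exact SMulMemClass.smul_mem c hx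

theorem isNormalOn_of_finiteDimensional_corner (hf : IsStateOn M f) {p : ↥M}
    (hp : IsProjection (p : H →L[ℂ] H)) (hfp : f p = 1)
    (hfin : FiniteDimensional ℂ ↥(Submodule.span ℂ (corner M (p : H →L[ℂ] H)))) :
    IsNormalOn M f := by
  set V := Submodule.span ℂ (corner M (p : H →L[ℂ] H)) with hV
  let ω (i : H × H) : Module.Dual ℂ V :=
    { toFun x := ⟪i.1, (x : H →L[ℂ] H) i.2⟫_ℂ
      map_add' x y := by simp
      map_smul' c x := by simp }
  let fV : Module.Dual ℂ V :=
    { toFun x := f ⟨x, span_corner_le p.2 x.2⟩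
      map_add' x y := map_add f ⟨x, span_corner_le p.2 x.2⟩ ⟨y, span_corner_le p.2 y.2⟩
      map_smul' c x := map_smul f c ⟨x, span_corner_le p.2 x.2⟩ }
  have htop : Submodule.span ℂ (Set.range ω) = ⊤ := by
    have hbot : (Submodule.span ℂ (Set.range ω)).dualCoannihilator = ⊥ := by
      rw [Submodule.eq_bot_iff]
      intro x hx
      rw [Submodule.mem_dualCoannihilator] at hx
      ext v
      have h1 : ⟪(x : H →L[ℂ] H) v, (x : H →L[ℂ] H) v⟫_ℂ = 0 :=
        hx (ω ((x : H →L[ℂ] H) v, v)) (Submodule.subset_span ⟨_, rfl⟩)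
      exact inner_self_eq_zero.1 h1
    rw [← Subspace.dualCoannihilator_dualAnnihilator_eq (W := Submodule.span ℂ (Set.range ω)), hbot,
      Submodule.dualAnnihilator_bot]
  obtain ⟨c, hc⟩ := Finsupp.mem_span_range_iff_exists_finsupp.1
    (htop ▸ Submodule.mem_top : fV ∈ Submodule.span ℂ (Set.range ω))
  refine isNormalOn_of_forall_eq c.support c (fun i => (p : H →L[ℂ] H) i.1)
    (fun i => (p : H →L[ℂ] H) i.2) fun x => ?_
  have hmem : ((p * x * p : ↥M) : H →L[ℂ] H) ∈ V := Submodule.subset_span ⟨x, x.2, rfl⟩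
  rw [← hf.map_corner hp hfp x]
  have h1 : f (p * x * p) = fV ⟨_, hmem⟩ := rfl
  rw [h1, ← hc, Finsupp.sum, LinearMap.sum_apply]
  refine Finset.sum_congr rfl fun i _ => ?_
  rw [hp.isSelfAdjoint.inner_left]
  rfl

/-- A classically normal singular pure state lives on an infinite-dimensional factor summand. -/
theorem exists_central_projection [TopologicalSpace.SeparableSpace H]
    (hf : IsPureStateOn M f) (hs : IsSingularOn M f) (hc : IsClassicallyNormalOn M f) :
    ∃ p : ↥M, IsProjection ((p : H →L[ℂ] H)) ∧
        (∀ x ∈ M, (p : H →L[ℂ] H) * x = x * p) ∧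
        CornerIsFactor M (p : H →L[ℂ] H) ∧
        ¬ FiniteDimensional ℂ ↥(Submodule.span ℂ (corner M (p : H →L[ℂ] H))) := by
  have hmul : IsMultiplicativeOn M f (M.center : Set (H →L[ℂ] H)) :=
    fun a b ha _ => hf.map_mul_of_mem_center ha b
  rcases exists_eigenvector_or_isVanishing center_subset hf.1 hmul with
    ⟨v, hv1, hv⟩ | ⟨Q, hQC, hQ, hfQ⟩
  swap
  · exact absurd (hc _ center_subset hmul) (not_isNormalOnSub_of_isVanishing _ hQC hQ hfQ)
  let K : Submodule ℂ H := ⨅ z : {z : ↥M // (z : H →L[ℂ] H) ∈ M.center},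
    ((z.1 : H →L[ℂ] H) - f z.1 • 1).ker
  have hKmem (w : H) : w ∈ K ↔ ∀ z : ↥M, (z : H →L[ℂ] H) ∈ M.center →
      (z : H →L[ℂ] H) w = f z • w := by
    simp only [K, Submodule.mem_iInf, Subtype.forall]
    refine forall_congr' fun z => forall₂_congr fun hz _ => ?_
    exact sub_eq_zero (a := z w) (b := f ⟨z, hz⟩ • w)
  have hKcl : IsClosed (K : Set H) := by
    simp only [K, Submodule.coe_iInf]
    exact isClosed_iInter fun z => ContinuousLinearMap.isClosed_ker _
  have : CompleteSpace K := hKcl.completeSpace_coe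
  have hinv (y : H →L[ℂ] H) (hy : ∀ z : ↥M, (z : H →L[ℂ] H) ∈ M.center →
      Commute (z : H →L[ℂ] H) y) (w : H) (hw : w ∈ K) : y w ∈ K := by
    rw [hKmem] at hw ⊢
    intro z hz
    have := congr($((hy z hz).eq) w)
    rw [mul_apply_eq_comp, mul_apply_eq_comp, hw z hz, map_smul] at this
    exact this
  have hpM : K.starProjection ∈ M :=
    starProjection_mem K fun y hy => hinv y fun z hz => commute_of_mem hz.1 hy
  have hpM' : K.starProjection ∈ M.commutant :=
    starProjection_mem K fun y hy => hinv y fun z hz => commute_of_mem hz.2 hy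
  have hp : IsProjection K.starProjection := isProjection_starProjection K
  have hzp (z : ↥M) (hz : (z : H →L[ℂ] H) ∈ M.center) :
      (z : H →L[ℂ] H) * K.starProjection = f z • K.starProjection := by
    ext w
    exact (hKmem _).1 (K.starProjection_apply_mem w) z hz
  have hvK : v ∈ K := (hKmem v).2 hv
  have hfp : f ⟨K.starProjection, hpM⟩ = 1 := by
    have h1 := hv ⟨K.starProjection, hpM⟩ ⟨hpM, hpM'⟩
    rw [show ((⟨K.starProjection, hpM⟩ : ↥M) : H →L[ℂ] H) v = v from
      K.starProjection_eq_self_iff.2 hvK] at h1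
    have hv0 : v ≠ 0 := fun h => by simp [h] at hv1
    refine smul_left_injective ℂ hv0 ?_
    simp only [one_smul]
    exact h1.symm
  have hcen (x : H →L[ℂ] H) (hx : x ∈ M) : K.starProjection * x = x * K.starProjection :=
    (commute_of_mem hx hpM').eq.symm
  refine ⟨⟨K.starProjection, hpM⟩, hp, hcen, ?_, fun hfin => ?_⟩
  · rintro _ ⟨a, ha, rfl⟩ hcomm
    dsimp only at hcomm ⊢
    have hxM : K.starProjection * a * K.starProjection ∈ M := mul_mem (mul_mem hpM ha) hpM
    have hxM' : K.starProjection * a * K.starProjection ∈ M.commutant := by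
      refine mem_commutant_iff.2 fun y hy => ?_
      have h1 := hcomm _ ⟨y, hy, rfl⟩
      dsimp only at h1
      have e1 : K.starProjection * a * K.starProjection *
          (K.starProjection * y * K.starProjection) =
          K.starProjection * a * K.starProjection * y := by
        rw [mul_assoc K.starProjection y, ← hcen y hy, ← mul_assoc, ← mul_assoc, mul_assoc _ _ K.starProjection, hp.2,
          mul_assoc _ _ K.starProjection, hp.2]
      have e2 : K.starProjection * y * K.starProjection *
          (K.starProjection * a * K.starProjection) =
          y * (K.starProjection * a * K.starProjection) := by
        rw [hcen y hy, mul_assoc y, hp.2, mul_assoc, ← mul_assoc K.starProjection,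
          ← mul_assoc K.starProjection, hp.2]
      rw [e1, e2] at h1
      exact h1.symm
    refine ⟨f ⟨_, hxM⟩, ?_⟩
    rw [← hzp ⟨_, hxM⟩ ⟨hxM, hxM'⟩]
    change _ = K.starProjection * a * K.starProjection * K.starProjection
    rw [mul_assoc _ K.starProjection K.starProjection, hp.2]
  · have hn := isNormalOn_of_finiteDimensional_corner hf.1 (p := ⟨K.starProjection, hpM⟩) hp hfp hfin
    have h0 : f = 0 := hs f hf.1.1 (by rw [sub_self]; exact fun a => le_rfl) hn
    have h1 := hf.1.2
    rw [h0] at h1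
    exact zero_ne_one h1

end Necessity

section Chains

variable {M : VonNeumannAlgebra H}

theorem IsProjection.sub {q e : H →L[ℂ] H} (hq : IsProjection q) (he : IsProjection e)
    (h : ProjLE e q) : IsProjection (q - e) :=
  ⟨by rw [star_sub, hq.1, he.1], by
    rw [sub_mul, mul_sub, mul_sub, hq.2, he.2, h.1, h.2]; abel⟩

theorem IsMinimalProjectionIn.apply_mem {e : H →L[ℂ] H}
    (he : IsMinimalProjectionIn (M : Set (H →L[ℂ] H)) e) {x : H →L[ℂ] H} (hx : x ∈ M) {v : H}
    (hv0 : v ≠ 0) (hv : e v = v) (hxv : x v = 0) (w : H) (hw : e w = w) : x w = 0 := by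
  let K : Submodule ℂ H := x.ker ⊓ (1 - e).ker
  have hKmem (u : H) : u ∈ K ↔ x u = 0 ∧ e u = u := by
    refine and_congr Iff.rfl ?_
    change u - e u = 0 ↔ _
    rw [sub_eq_zero, eq_comm]
  have hKcl : IsClosed (K : Set H) := x.isClosed_ker.inter (1 - e).isClosed_ker
  have : CompleteSpace K := hKcl.completeSpace_coe
  have hKM : K.starProjection ∈ M := by
    refine starProjection_mem K fun y hy u hu => ?_
    rw [hKmem] at hu ⊢
    have h1 := congr($((commute_of_mem hx hy).eq) u)
    have h2 := congr($((commute_of_mem he.1 hy).eq) u)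
    rw [mul_apply_eq_comp, mul_apply_eq_comp] at h1 h2
    rw [h1, h2, hu.1, hu.2, map_zero]
    exact ⟨rfl, rfl⟩
  have hle : e * K.starProjection = K.starProjection := by
    ext u
    exact ((hKmem _).1 (K.starProjection_apply_mem u)).2
  have hle' : K.starProjection * e = K.starProjection := by
    have := congr_arg star hle
    rwa [star_mul, he.2.1.1, (isProjection_starProjection K).1] at this
  rcases he.2.2.2 _ hKM (isProjection_starProjection K) ⟨hle', hle⟩ with h | h
  · have : K.starProjection v = v := K.starProjection_eq_self_iff.2 ((hKmem v).2 ⟨hxv, hv⟩)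
    rw [h] at this
    exact absurd this.symm hv0
  · rw [← h] at hw
    exact ((hKmem w).1 (K.starProjection_eq_self_iff.1 hw)).1

theorem IsMinimalProjectionIn.exists_smul_of_isSelfAdjoint {e : H →L[ℂ] H}
    (he : IsMinimalProjectionIn (M : Set (H →L[ℂ] H)) e) {z : H →L[ℂ] H} (hz : z ∈ M)
    (hsa : IsSelfAdjoint z) (hez : e * z = z) (hze : z * e = z) : ∃ c : ℂ, z = c • e := by
  obtain ⟨v, hv0, hv⟩ : ∃ v, v ≠ 0 ∧ e v = v := by
    by_contra! h
    refine he.2.2.1 (ContinuousLinearMap.ext fun v => ?_)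
    by_contra h0
    exact h _ h0 (he.2.1.apply_apply v)
  let r : ℝ := (⟪v, z v⟫_ℂ).re / ‖v‖ ^ 2
  let w := z - r • e
  have hwM : w ∈ M := sub_mem hz (VonNeumannAlgebra.real_smul_mem he.1 r)
  have hwsa : IsSelfAdjoint w := hsa.sub ((IsSelfAdjoint.all r).smul he.2.1.1)
  have hwe : Commute w e := by
    change (z - r • e) * e = e * (z - r • e)
    rw [sub_mul, mul_sub, hez, hze, smul_mul_assoc, mul_smul_comm]
  have hv2 : (⟪v, w v⟫_ℂ).re = 0 := by
    change (⟪v, z v - r • e v⟫_ℂ).re = 0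
    rw [inner_sub_right, Complex.sub_re, re_inner_real_smul, hv, re_inner_self,
      div_mul_cancel₀ _ (by positivity), sub_self]
  let a := cfc (fun t : ℝ => max t 0) w
  let b := cfc (fun t : ℝ => max (-t) 0) w
  have ha0 : 0 ≤ a := cfc_nonneg fun t _ => le_max_right _ _
  have hb0 : 0 ≤ b := cfc_nonneg fun t _ => le_max_right _ _
  have hab : a * b = 0 := by
    simp only [a, b]
    rw [← cfc_mul _ _ w, ← cfc_zero ℝ w]
    refine cfc_congr fun t _ => ?_
    rcases le_total t 0 with h | h <;> simp [h]
  have hw : w = a - b := by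
    simp only [a, b]
    rw [← cfc_sub _ _ w]
    conv_lhs => rw [← cfc_id' ℝ w]
    refine cfc_congr fun t _ => ?_
    rcases le_total t 0 with h | h <;> simp [h]
  have hwv : w v = 0 := by
    by_cases hbz : b v = 0
    · have h1 : w v = a v := by rw [hw, _root_.sub_apply, hbz, sub_zero]
      rw [h1] at hv2 ⊢
      exact apply_eq_zero_of_re_inner ha0 hv2.le
    · have hbe : e (b v) = b v := by
        have := congr($((hwsa.commute_cfc hwe (fun t : ℝ => max (-t) 0)).eq) v)
        rw [mul_apply_eq_comp, mul_apply_eq_comp, hv] at this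
        exact this.symm
      have h1 : a v = 0 := he.apply_mem (cfc_mem hwM hwsa _) hbz hbe
        (congr($hab v)) v hv
      have h2 : w v = -b v := by rw [hw, _root_.sub_apply, h1, zero_sub]
      rw [h2, inner_neg_right, Complex.neg_re, neg_eq_zero] at hv2
      exact absurd (apply_eq_zero_of_re_inner hb0 hv2.le) hbz
  refine ⟨(r : ℂ), ?_⟩
  rw [Complex.coe_smul]
  ext u
  have h1 : w (e u) = 0 := he.apply_mem hwM hv0 hv hwv (e u) (he.2.1.apply_apply u)
  have h2 : z (e u) - r • e (e u) = 0 := h1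
  have h3 : z (e u) = z u := congr($hze u)
  rw [he.2.1.apply_apply, sub_eq_zero, h3] at h2
  exact h2

theorem IsMinimalProjectionIn.exists_smul {e : H →L[ℂ] H}
    (he : IsMinimalProjectionIn (M : Set (H →L[ℂ] H)) e) {x : H →L[ℂ] H} (hx : x ∈ M) :
    ∃ c : ℂ, e * x * e = c • e := by
  have key (y : H →L[ℂ] H) (hy : y ∈ M) (hsa : IsSelfAdjoint y) : ∃ c : ℂ, e * y * e = c • e := by
    refine he.exists_smul_of_isSelfAdjoint (mul_mem (mul_mem he.1 hy) he.1) ?_ ?_ ?_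
    · have := hsa.conjugate e
      rwa [he.2.1.1] at this
    · rw [← mul_assoc, ← mul_assoc, he.2.1.2]
    · rw [mul_assoc, he.2.1.2]
  obtain ⟨c, hc⟩ := key (ℜ x : H →L[ℂ] H) (by
    rw [realPart_apply_coe]
    exact VonNeumannAlgebra.real_smul_mem (add_mem hx (star_mem hx)) _) (ℜ x).2
  obtain ⟨d, hd⟩ := key (ℑ x : H →L[ℂ] H) (by
    rw [imaginaryPart_apply_coe]
    exact SMulMemClass.smul_mem (-Complex.I)
      (VonNeumannAlgebra.real_smul_mem (sub_mem hx (star_mem hx)) _)) (ℑ x).2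
  refine ⟨c + Complex.I * d, ?_⟩
  conv_lhs => rw [← realPart_add_I_smul_imaginaryPart x]
  rw [mul_add, add_mul, hc, mul_smul_comm, smul_mul_assoc, hd, smul_smul, add_smul]

/-- The map `x ↦ a x b` on a von Neumann algebra. -/
noncomputable def mulMulMap (M : VonNeumannAlgebra H) (a b : H →L[ℂ] H) :
    ↥M →ₗ[ℂ] (H →L[ℂ] H) where
  toFun x := a * x * b
  map_add' x y := by simp [mul_add, add_mul]
  map_smul' c x := by simp

theorem finiteDimensional_range_mulMulMap {e e' : H →L[ℂ] H}
    (he : IsMinimalProjectionIn (M : Set (H →L[ℂ] H)) e)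
    (he' : IsMinimalProjectionIn (M : Set (H →L[ℂ] H)) e') :
    FiniteDimensional ℂ (mulMulMap M e e').range := by
  by_cases h : ∃ x : ↥M, e * (x : H →L[ℂ] H) * e' ≠ 0
  · obtain ⟨x, hx⟩ := h
    obtain ⟨u, hu⟩ : ∃ u, u = e * (x : H →L[ℂ] H) * e' := ⟨_, rfl⟩
    rw [← hu] at hx
    have huM : u ∈ M := hu ▸ mul_mem (mul_mem he.1 x.2) he'.1
    have hue : u * e' = u := by rw [hu, mul_assoc, he'.2.1.2]
    have heu : e * u = u := by rw [hu, ← mul_assoc, ← mul_assoc, he.2.1.2]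
    have hus : star u * e = star u := by
      have := congr_arg star heu
      rwa [star_mul, he.2.1.1] at this
    obtain ⟨c, hc⟩ := he'.exists_smul (mul_mem (star_mem huM) huM)
    have hc' : star u * u = c • e' := by
      have h1 := congr_arg star hue
      rw [star_mul, he'.2.1.1] at h1
      calc star u * u = (e' * star u) * (u * e') := by rw [hue, h1]
        _ = e' * (star u * u) * e' := by simp only [mul_assoc]
        _ = c • e' := hc
    have hc0 : c ≠ 0 := by
      rintro rfl
      rw [zero_smul] at hc'
      exact hx ((CStarRing.star_mul_self_eq_zero_iff u).1 hc')
    have hle : (mulMulMap M e e').range ≤ Submodule.span ℂ {u} := by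
      rintro _ ⟨y, rfl⟩
      change e * (y : H →L[ℂ] H) * e' ∈ _
      obtain ⟨d, hd⟩ := he.exists_smul (mul_mem (mul_mem y.2 he'.1) (star_mem huM))
      refine Submodule.mem_span_singleton.2 ⟨c⁻¹ * d, ?_⟩
      have h1 : e * ((y : H →L[ℂ] H) * e' * star u) * e * u = c • (e * (y : H →L[ℂ] H) * e') := by
        calc e * ((y : H →L[ℂ] H) * e' * star u) * e * u
            = e * (y : H →L[ℂ] H) * e' * ((star u * e) * u) := by simp only [mul_assoc]
          _ = e * (y : H →L[ℂ] H) * (e' * (c • e')) := by rw [hus, hc']; simp only [mul_assoc]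
          _ = _ := by rw [mul_smul_comm, he'.2.1.2, mul_smul_comm]
      rw [hd, smul_mul_assoc, heu] at h1
      rw [mul_smul, h1, smul_smul, inv_mul_cancel₀ hc0, one_smul]
    exact Submodule.finiteDimensional_of_le hle
  · push Not at h
    have : mulMulMap M e e' = 0 := LinearMap.ext h
    rw [this, LinearMap.range_zero]
    infer_instance

/-- An infinite-dimensional corner contains nonzero projections decreasing to zero. -/
theorem exists_isVanishing_of_not_finiteDimensional {p : H →L[ℂ] H} (hpM : p ∈ M)
    (hp : IsProjection p)
    (hinf : ¬ FiniteDimensional ℂ ↥(Submodule.span ℂ (corner M p))) :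
    ∃ Q : ℕ → H →L[ℂ] H, IsVanishing Q ∧ (∀ n, Q n ∈ M) ∧ (∀ n, Q n ≠ 0) ∧
      ∀ n, p * Q n = Q n := by
  let T := {q : H →L[ℂ] H // q ∈ M ∧ IsProjection q}
  let r (q q' : T) : Prop := ProjLE q.1 q'.1 ∧ q.1 ≠ q'.1
  by_cases hacc : Acc r ⟨p, hpM, hp⟩
  · exfalso
    let Min := {e : H →L[ℂ] H | IsMinimalProjectionIn (M : Set (H →L[ℂ] H)) e}
    have hcl : ∀ q : T, Acc r q → q.1 ∈ AddSubmonoid.closure Min := by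
      intro q hq
      induction hq with
      | intro q _ ih =>
        by_cases h0 : q.1 = 0
        · rw [h0]; exact zero_mem _
        by_cases hm : IsMinimalProjectionIn (M : Set (H →L[ℂ] H)) q.1
        · exact AddSubmonoid.subset_closure hm
        obtain ⟨e, heM, he, hle, he0, heq⟩ : ∃ e ∈ M, IsProjection e ∧ ProjLE e q.1 ∧ e ≠ 0 ∧
            e ≠ q.1 := by
          by_contra! h
          refine hm ⟨q.2.1, q.2.2, h0, fun e heM he hle => ?_⟩
          by_contra! h2
          exact h2.2 (h e heM he hle h2.1)
        have h1 := ih ⟨e, heM, he⟩ ⟨hle, heq⟩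
        have h2 := ih ⟨q.1 - e, sub_mem q.2.1 heM, q.2.2.sub he hle⟩ ⟨⟨by
          simp [sub_mul, q.2.2.2, hle.1], by simp [mul_sub, q.2.2.2, hle.2]⟩, by simpa using he0⟩
        simpa using add_mem h1 h2
    have hfin : ∀ a ∈ AddSubmonoid.closure Min, ∀ b ∈ AddSubmonoid.closure Min,
        FiniteDimensional ℂ (mulMulMap M a b).range := by
      intro a ha b hb
      induction ha, hb using AddSubmonoid.closure_induction₂ with
      | mem a b ha hb => exact finiteDimensional_range_mulMulMap ha hb
      | zero_left b _ =>
        have : mulMulMap M 0 b = 0 := LinearMap.ext fun x => by simp [mulMulMap]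
        rw [this, LinearMap.range_zero]
        infer_instance
      | zero_right a _ =>
        have : mulMulMap M a 0 = 0 := LinearMap.ext fun x => by simp [mulMulMap]
        rw [this, LinearMap.range_zero]
        infer_instance
      | add_left a b c _ _ _ h1 h2 =>
        have : mulMulMap M (a + b) c = mulMulMap M a c + mulMulMap M b c :=
          LinearMap.ext fun x => by simp [mulMulMap, add_mul]
        rw [this]
        exact Submodule.finiteDimensional_of_le (LinearMap.range_add_le _ _)
      | add_right a b c _ _ _ h1 h2 =>
        have : mulMulMap M c (a + b) = mulMulMap M c a + mulMulMap M c b :=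
          LinearMap.ext fun x => by simp [mulMulMap, mul_add]
        rw [this]
        exact Submodule.finiteDimensional_of_le (LinearMap.range_add_le _ _)
    have hpc := hcl _ hacc
    have := hfin p hpc p hpc
    refine hinf (Submodule.finiteDimensional_of_le (S₂ := (mulMulMap M p p).range) ?_)
    rw [Submodule.span_le]
    rintro _ ⟨x, hx, rfl⟩
    exact ⟨⟨x, hx⟩, rfl⟩
  · obtain ⟨P, hP0, hP⟩ := not_acc_iff_exists_descending_chain.1 hacc
    have hle : ∀ m n, m ≤ n → (P m).1 * (P n).1 = (P n).1 := by
      intro m n hmn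
      induction n, hmn using Nat.le_induction with
      | base => exact (P m).2.2.2
      | succ n _ ih => rw [← (hP n).1.2, ← mul_assoc, ih]
    let K : Submodule ℂ H := ⨅ n, (1 - (P n).1).ker
    have hKmem (v : H) : v ∈ K ↔ ∀ n, (P n).1 v = v := by
      simp only [K, Submodule.mem_iInf]
      refine forall_congr' fun n => ?_
      change v - (P n).1 v = 0 ↔ _
      rw [sub_eq_zero, eq_comm]
    have hKcl : IsClosed (K : Set H) := by
      simp only [K, Submodule.coe_iInf]
      exact isClosed_iInter fun z => ContinuousLinearMap.isClosed_ker _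
    have : CompleteSpace K := hKcl.completeSpace_coe
    have hE := isProjection_starProjection K
    have hEM : K.starProjection ∈ M := by
      refine starProjection_mem K fun y hy v hv => ?_
      rw [hKmem] at hv ⊢
      intro n
      have h1 := congr($((commute_of_mem (P n).2.1 hy).eq) v)
      rw [mul_apply_eq_comp, mul_apply_eq_comp, hv n] at h1
      exact h1
    have hPE (n : ℕ) : (P n).1 * K.starProjection = K.starProjection := by
      ext v
      exact (hKmem _).1 (K.starProjection_apply_mem v) n
    have hEP (n : ℕ) : K.starProjection * (P n).1 = K.starProjection := by
      have := congr_arg star (hPE n)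
      rwa [star_mul, hE.1, (P n).2.2.1] at this
    refine ⟨fun n => (P n).1 - K.starProjection, isVanishing_of_forall_eq_zero
      (fun n => (P n).2.2.sub hE ⟨hEP n, hPE n⟩) (fun m n h => ?_) (fun v hv => ?_),
      fun n => sub_mem (P n).2.1 hEM, fun n h => ?_, fun n => ?_⟩
    · rw [sub_mul, mul_sub, mul_sub, hle m n h, hPE, hEP, hE.2]
      abel
    · have hvn (n : ℕ) : (P n).1 v = v := by
        have h1 := hv n
        rw [_root_.sub_apply] at h1
        have h2 := congr_arg (P n).1 h1
        have h3 : (P n).1 (K.starProjection v) = K.starProjection v := congr($(hPE n) v)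
        rw [map_sub, (P n).2.2.apply_apply, h3, h1] at h2
        exact h2.symm
      have h1 := hv 0
      rw [_root_.sub_apply, hvn 0, K.starProjection_eq_self_iff.2 ((hKmem v).2 hvn),
        sub_self] at h1
      exact h1.symm
    · have h1 := (hP n).1.1
      have h2 := sub_eq_zero.1 h
      rw [h2, hPE] at h1
      exact (hP n).2 (by rw [← h1, h2])
    · have h1 := hle 0 n (Nat.zero_le _)
      have h2 := hPE 0
      rw [hP0] at h1 h2
      rw [mul_sub, h1, h2]

end Chains

section BlockSums

/-- A uniformly bounded sequence of operators which is block diagonal with respect to the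
consecutive differences of the projections `R n`. -/
structure IsBlockSeq (R z : ℕ → H →L[ℂ] H) : Prop where
  block : ∀ k, (R k - R (k + 1)) * z k * (R k - R (k + 1)) = z k
  norm_le : ∀ k v, ‖z k v‖ ≤ ‖v‖

/-- The strong limit of the partial sums of `z` is `y`. -/
def IsStrongSum (z : ℕ → H →L[ℂ] H) (y : H →L[ℂ] H) : Prop :=
  ∀ v, Tendsto (fun n => (∑ l ∈ Finset.range n, z l) v) atTop (𝓝 (y v))

variable {R z z' z'' : ℕ → H →L[ℂ] H} {y y' y'' : H →L[ℂ] H}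

theorem IsVanishing.isProjection_sub (hR : IsVanishing R) {m n : ℕ} (h : m ≤ n) :
    IsProjection (R m - R n) :=
  (hR.isProjection m).sub (hR.isProjection n) ⟨hR.mul_of_le' h, hR.mul_of_le m n h⟩

theorem IsVanishing.sub_mul_of_le (hR : IsVanishing R) {k l n : ℕ} (hkl : k ≤ l) (hl : l ≤ n) :
    (R k - R l) * R n = 0 := by
  rw [sub_mul, hR.mul_of_le k n (hkl.trans hl), hR.mul_of_le l n hl, sub_self]

theorem IsVanishing.mul_sub_of_le (hR : IsVanishing R) {k l n : ℕ} (hkl : k ≤ l) (hl : l ≤ n) :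
    R n * (R k - R l) = 0 := by
  rw [mul_sub, hR.mul_of_le' (hkl.trans hl), hR.mul_of_le' hl, sub_self]

theorem IsVanishing.mul_eq_zero (hR : IsVanishing R) {k l : ℕ} (h : k ≠ l) :
    (R k - R (k + 1)) * (R l - R (l + 1)) = 0 := by
  rcases h.lt_or_gt with h | h
  · rw [mul_sub, hR.sub_mul_of_le (by omega) h, hR.sub_mul_of_le (by omega) (by omega), sub_self]
  · rw [sub_mul, hR.mul_sub_of_le (by omega) (by omega), hR.mul_sub_of_le (by omega) (by omega),
      sub_self]

namespace IsBlockSeq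

theorem mul_right (hR : IsVanishing R) (hz : IsBlockSeq R z) (k : ℕ) :
    z k * (R k - R (k + 1)) = z k := by
  rw [← hz.block k, mul_assoc, (hR.isProjection_sub k.le_succ).2]

theorem mul_left (hR : IsVanishing R) (hz : IsBlockSeq R z) (k : ℕ) :
    (R k - R (k + 1)) * z k = z k := by
  rw [← hz.block k, ← mul_assoc, ← mul_assoc, (hR.isProjection_sub k.le_succ).2]

theorem mul_eq_zero (hR : IsVanishing R) (hz : IsBlockSeq R z) (hz' : IsBlockSeq R z') {k l : ℕ}
    (h : k ≠ l) : z k * z' l = 0 := by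
  rw [← hz.mul_right hR k, ← hz'.mul_left hR l, mul_assoc, ← mul_assoc _ _ (z' l),
    hR.mul_eq_zero h, zero_mul, mul_zero]

theorem sum_mul_sum (hR : IsVanishing R) (hz : IsBlockSeq R z) (hz' : IsBlockSeq R z') (n : ℕ) :
    (∑ l ∈ Finset.range n, z l) * (∑ l ∈ Finset.range n, z' l) =
      ∑ l ∈ Finset.range n, z l * z' l := by
  rw [Finset.sum_mul_sum]
  refine Finset.sum_congr rfl fun i hi => ?_
  refine Finset.sum_eq_single_of_mem i hi fun j _ hj => hz.mul_eq_zero hR hz' hj.symm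

theorem sum_mul_of_le (hR : IsVanishing R) (hz : IsBlockSeq R z) (n : ℕ) :
    (∑ l ∈ Finset.range n, z l) * R n = 0 := by
  rw [Finset.sum_mul]
  refine Finset.sum_eq_zero fun l hl => ?_
  rw [← hz.mul_right hR l, mul_assoc, hR.sub_mul_of_le l.le_succ (Finset.mem_range.1 hl),
    mul_zero]

theorem mul_sum_of_le (hR : IsVanishing R) (hz : IsBlockSeq R z) (n : ℕ) :
    R n * (∑ l ∈ Finset.range n, z l) = 0 := by
  rw [Finset.mul_sum]
  refine Finset.sum_eq_zero fun l hl => ?_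
  rw [← hz.mul_left hR l, ← mul_assoc, hR.mul_sub_of_le l.le_succ (Finset.mem_range.1 hl),
    zero_mul]

theorem norm_sq_add {q : H →L[ℂ] H} (hq : IsProjection q) {v w : H} (hv : q v = 0) (hw : q w = w) :
    ‖v + w‖ ^ 2 = ‖v‖ ^ 2 + ‖w‖ ^ 2 := by
  have : ⟪v, w⟫_ℂ = 0 := by rw [← hw, ← hq.isSelfAdjoint.inner_left, hv, inner_zero_left]
  have := norm_add_sq_eq_norm_sq_add_norm_sq_of_inner_eq_zero v w this
  simpa only [sq] using this

theorem norm_sum_apply_le (hR : IsVanishing R) (hz : IsBlockSeq R z) (n : ℕ) (v : H) :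
    ‖(∑ l ∈ Finset.range n, z l) v‖ ≤ ‖v‖ := by
  suffices h : ‖(∑ l ∈ Finset.range n, z l) v‖ ^ 2 ≤ ‖v - R n v‖ ^ 2 by
    refine (abs_le_of_sq_le_sq' h (norm_nonneg _)).2.trans ?_
    exact (hR.isProjection n).one_sub.norm_apply_le v
  induction n with
  | zero => simp
  | succ n ih =>
    have h1 : R n ((∑ l ∈ Finset.range n, z l) v) = 0 := congr($(hz.mul_sum_of_le hR n) v)
    have h2 : R n (z n v) = z n v := by
      have : R n * z n = z n := by
        rw [← hz.mul_left hR n, ← mul_assoc, mul_sub, (hR.isProjection n).2,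
          hR.mul_of_le n _ n.le_succ]
      exact congr($this v)
    have h3 : R n (R (n + 1) v) = R (n + 1) v := congr($(hR.mul_of_le n _ n.le_succ) v)
    rw [Finset.sum_range_succ, _root_.add_apply, norm_sq_add (hR.isProjection n) h1 h2]
    have h4 : v - R (n + 1) v = (v - R n v) + (R n v - R (n + 1) v) := by abel
    rw [h4, norm_sq_add (hR.isProjection n)
      (by rw [map_sub, (hR.isProjection n).apply_apply, sub_self])
      (by rw [map_sub, (hR.isProjection n).apply_apply, h3])]
    refine add_le_add ih ?_
    have h5 : z n v = z n (R n v - R (n + 1) v) := congr($((hz.mul_right hR n).symm) v)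
    rw [h5]
    gcongr
    exact hz.norm_le n _

theorem exists_isStrongSum (hR : IsVanishing R) (hz : IsBlockSeq R z) :
    ∃ y, IsStrongSum z y := by
  have hc (v : H) : ∃ w, Tendsto (fun n => (∑ l ∈ Finset.range n, z l) v) atTop (𝓝 w) := by
    refine cauchySeq_tendsto_of_complete (Metric.cauchySeq_iff'.2 fun ε hε => ?_)
    obtain ⟨N, hN⟩ := ((hR.tendsto v).norm.eventually (gt_mem_nhds (by simpa using hε))).exists
    refine ⟨N, fun n hn => ?_⟩
    rw [dist_eq_norm]
    have hdecomp (k : ℕ) (hk : N ≤ k) : (∑ l ∈ Finset.range k, z l) v =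
        (∑ l ∈ Finset.range N, z l) v + (∑ l ∈ Finset.range k, z l) (R N v) := by
      have h0 : (∑ l ∈ Finset.range N, z l) (R N v) = 0 := congr($(hz.sum_mul_of_le hR N) v)
      have : ∀ l ∈ Finset.Ico N k, z l v = z l (R N v) := by
        intro l hl
        have hl := Finset.mem_Ico.1 hl
        have : z l * R N = z l := by
          rw [← hz.mul_right hR l, mul_assoc, sub_mul, hR.mul_of_le' hl.1,
            hR.mul_of_le' (hl.1.trans l.le_succ)]
        exact congr($(this.symm) v)
      rw [← Finset.sum_range_add_sum_Ico _ hk, _root_.add_apply, _root_.add_apply, h0, zero_add]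
      congr 1
      simp only [_root_.sum_apply]
      exact Finset.sum_congr rfl this
    rw [hdecomp n hn, add_sub_cancel_left]
    exact (hz.norm_sum_apply_le hR n _).trans_lt hN
  choose w hw using hc
  let L : H →ₗ[ℂ] H :=
    { toFun := w
      map_add' := fun a b => tendsto_nhds_unique (hw (a + b)) (by
        simpa only [map_add] using (hw a).add (hw b))
      map_smul' := fun c a => tendsto_nhds_unique (hw (c • a)) (by
        simpa only [map_smul, RingHom.id_apply] using (hw a).const_smul c) }
  exact ⟨L.mkContinuous 1 fun v => by
    rw [one_mul]
    exact le_of_tendsto (hw v).norm (.of_forall fun n => hz.norm_sum_apply_le hR n v), hw⟩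

theorem norm_apply_le_of_isStrongSum (hR : IsVanishing R) (hz : IsBlockSeq R z)
    (hy : IsStrongSum z y) (v : H) : ‖y v‖ ≤ ‖v‖ :=
  le_of_tendsto (hy v).norm (.of_forall fun n => hz.norm_sum_apply_le hR n v)

theorem mul_eq_of_isStrongSum (hR : IsVanishing R) (hz : IsBlockSeq R z) (hz' : IsBlockSeq R z')
    (h : ∀ k, z k * z' k = z'' k) (hy : IsStrongSum z y) (hy' : IsStrongSum z' y')
    (hy'' : IsStrongSum z'' y'') : y * y' = y'' := by
  ext v
  refine tendsto_nhds_unique (l := atTop) (f := fun n => (∑ l ∈ Finset.range n, z l)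
    ((∑ l ∈ Finset.range n, z' l) v)) ?_ ?_
  · have h1 : Tendsto (fun n => (∑ l ∈ Finset.range n, z' l) v - y' v) atTop (𝓝 0) :=
      tendsto_sub_nhds_zero_iff.2 (hy' v)
    have h2 := squeeze_zero_norm (fun n => hz.norm_sum_apply_le hR n _)
      (tendsto_zero_iff_norm_tendsto_zero.1 h1)
    have h3 := h2.add (hy (y' v))
    rw [zero_add] at h3
    exact h3.congr fun n => by rw [map_sub, sub_add_cancel]
  · refine (hy'' v).congr fun n => ?_
    rw [← mul_apply_eq_comp, hz.sum_mul_sum hR hz']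
    simp only [h]

theorem block_of_isStrongSum (hR : IsVanishing R) (hz : IsBlockSeq R z) (hy : IsStrongSum z y)
    (k : ℕ) : (R k - R (k + 1)) * y * (R k - R (k + 1)) = z k := by
  ext v
  have h1 := ((R k - R (k + 1)).continuous.tendsto _).comp (hy ((R k - R (k + 1)) v))
  refine tendsto_nhds_unique h1 (tendsto_const_nhds.congr' ?_)
  filter_upwards [eventually_gt_atTop k] with n hn
  have : (R k - R (k + 1)) * (∑ l ∈ Finset.range n, z l) * (R k - R (k + 1)) = z k := by
    rw [Finset.mul_sum, Finset.sum_eq_single_of_mem k (Finset.mem_range.2 hn), hz.block]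
    intro l _ hl
    rw [← hz.mul_left hR l, ← mul_assoc, hR.mul_eq_zero hl.symm, zero_mul]
  exact congr($(this.symm) v)

end IsBlockSeq

theorem IsStrongSum.isSelfAdjoint (hy : IsStrongSum z y) (hz : ∀ k, IsSelfAdjoint (z k)) :
    IsSelfAdjoint y := by
  rw [ContinuousLinearMap.isSelfAdjoint_iff_isSymmetric]
  intro v w
  refine tendsto_nhds_unique ((hy v).inner tendsto_const_nhds)
    ((tendsto_const_nhds.inner (hy w)).congr fun n => ?_)
  exact ((isSelfAdjoint_sum _ fun k _ => hz k).inner_left v w).symm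

theorem IsStrongSum.mem {M : VonNeumannAlgebra H} (hy : IsStrongSum z y) (hz : ∀ k, z k ∈ M) :
    y ∈ M :=
  mem_of_tendsto (fun _ => sum_mem fun k _ => hz k) hy

end BlockSums

section Blocks

variable {M : VonNeumannAlgebra H} {p : H →L[ℂ] H}

/-- The norm of `S * b` is controlled by the values of `S * b` on the range of `b`. -/
theorem norm_le_half_of_forall_range {S b : H →L[ℂ] H} (hb : IsSelfAdjoint b)
    (h : ∀ w, ‖(S * b) (b w)‖ ≤ 1 / 2 * ‖b w‖) : ‖S * b‖ ≤ 1 / 2 := by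
  let K : Submodule ℂ H := b.range.topologicalClosure
  have : CompleteSpace K := b.range.isClosed_topologicalClosure.completeSpace_coe
  have hK : ∀ w ∈ K, ‖(S * b) w‖ ≤ 1 / 2 * ‖w‖ := by
    have hcl : IsClosed {w : H | ‖(S * b) w‖ ≤ 1 / 2 * ‖w‖} :=
      isClosed_le (by fun_prop) (by fun_prop)
    intro w hw
    refine closure_minimal ?_ hcl hw
    rintro _ ⟨u, rfl⟩
    exact h u
  refine ContinuousLinearMap.opNorm_le_bound _ (by norm_num) fun u => ?_
  have h1 : b (u - K.starProjection u) = 0 := by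
    have h2 := K.sub_starProjection_mem_orthogonal u
    rw [← inner_self_eq_zero (𝕜 := ℂ), ← hb.inner_left]
    exact h2 _ (b.range.le_topologicalClosure ⟨_, rfl⟩)
  have h2 : (S * b) u = (S * b) (K.starProjection u) := by
    rw [mul_apply_eq_comp, mul_apply_eq_comp]
    rw [map_sub, sub_eq_zero] at h1
    rw [h1]
  rw [h2]
  refine (hK _ (K.starProjection_apply_mem u)).trans ?_
  have := (isProjection_starProjection K).norm_apply_le u
  linarith

/-- In a factor, a contraction moves some unit vector of the range of `b` substantially into the
range of `a`. -/
theorem exists_contraction (hpM : p ∈ M) (hp : IsProjection p) (hcen : ∀ x ∈ M, p * x = x * p)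
    (hfac : CornerIsFactor M p) {a b : H →L[ℂ] H} (ha : a ∈ M) (hb : b ∈ M)
    (hbsa : IsSelfAdjoint b) (hap : a * p ≠ 0) (hbp : b * p ≠ 0) :
    ∃ t ∈ M, (∀ w, ‖t w‖ ≤ ‖w‖) ∧ ∃ u u' : H, ‖b u‖ = 1 ∧ 1 / 2 ≤ ‖t (b u)‖ ∧
      t (b u) = a u' := by
  obtain ⟨x, hxM, hx⟩ := exists_mul_mul_ne_zero hpM hp hcen hfac hb hap hbp
  have hn : ‖a * x * b‖ ≠ 0 := norm_ne_zero_iff.2 hx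
  let c : ℂ := ((‖a * x * b‖⁻¹ : ℝ) : ℂ)
  have hcn : ‖c‖ = ‖a * x * b‖⁻¹ := by simp [c]
  have htn : ‖c • (a * x * b)‖ = 1 := by rw [norm_smul, hcn, inv_mul_cancel₀ hn]
  have hex : ∃ w, 1 / 2 * ‖b w‖ < ‖(c • (a * x * b)) (b w)‖ := by
    by_contra! h
    have h1 : c • (a * x * b) = (c • (a * x)) * b := by rw [smul_mul_assoc]
    rw [h1] at h htn
    have := norm_le_half_of_forall_range hbsa h
    rw [htn] at this
    norm_num at this
  obtain ⟨w, hw⟩ := hex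
  have hw0 : ‖b w‖ ≠ 0 := by
    intro h
    rw [norm_eq_zero.1 h] at hw
    simp at hw
  let r : ℂ := ((‖b w‖⁻¹ : ℝ) : ℂ)
  have hrn : ‖r‖ = ‖b w‖⁻¹ := by simp [r]
  refine ⟨c • (a * x * b), M.toStarSubalgebra.smul_mem (mul_mem (mul_mem ha hxM) hb) c,
    fun v => by simpa [htn] using (c • (a * x * b)).le_opNorm v,
    r • w, c • r • x (b (b w)), ?_, ?_, ?_⟩
  · rw [map_smul, norm_smul, hrn, inv_mul_cancel₀ hw0]
  · rw [map_smul, map_smul, norm_smul, hrn, inv_mul_eq_div, le_div_iff₀ (by positivity)]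
    exact hw.le
  · simp [smul_smul, mul_comm]

theorem norm_le_of_sq_le {E : Type*} [SeminormedAddGroup E] {x : E} {s : ℝ} (hs : 0 ≤ s)
    (h : ‖x‖ ^ 2 ≤ s ^ 2) : ‖x‖ ≤ s := by
  exact (abs_le_of_sq_le_sq' h hs).2

theorem re_inner_add_le {d : H →L[ℂ] H} (hd : 0 ≤ d) (v w : H) :
    (⟪v + w, d (v + w)⟫_ℂ).re ≤ 2 * (⟪v, d v⟫_ℂ).re + 2 * (⟪w, d w⟫_ℂ).re := by
  have h := re_inner_nonneg hd (v - w)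
  simp only [map_add, map_sub, inner_add_left, inner_add_right, inner_sub_left, inner_sub_right,
    Complex.add_re, Complex.sub_re] at h ⊢
  linarith

/-- A vector almost annihilated by `d` and by `1 - Q m`, together with a partial transport between
two consecutive blocks of `Q` which it detects. -/
theorem exists_block (hpM : p ∈ M) (hp : IsProjection p) (hcen : ∀ x ∈ M, p * x = x * p)
    (hfac : CornerIsFactor M p) {Q : ℕ → H →L[ℂ] H} (hQ : IsVanishing Q) (hQM : ∀ n, Q n ∈ M)
    {d : H →L[ℂ] H} (hdM : d ∈ M) (hd : 0 ≤ d) {s : ℝ} (hs : 0 < s)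
    (hlow : ∀ m, ∃ v, p v = v ∧ (⟪v, (d + (1 - Q m)) v⟫_ℂ).re < s ^ 2 * ‖v‖ ^ 2) (m : ℕ) :
    ∃ (m' m'' : ℕ) (t : H →L[ℂ] H) (v : H), m < m' ∧ m' < m'' ∧ t ∈ M ∧ (∀ w, ‖t w‖ ≤ ‖w‖) ∧
      ‖v‖ ≤ 2 ∧ (⟪v, d v⟫_ℂ).re ≤ 4 * s ^ 2 ∧ ‖v - (Q m - Q m'') v‖ ≤ 6 * s ∧
      1 / 4 - 9 * s ≤ (⟪v, ((Q m - Q m') * t * (Q m' - Q m'')) v⟫_ℂ).re := by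
  have hcut (D : H →L[ℂ] H) (hDM : D ∈ M) (hD : IsSelfAdjoint D) (v : H) (hpv : p v = v)
      (hv : (⟪v, D v⟫_ℂ).re < s ^ 2 * ‖v‖ ^ 2) : ∃ a ∈ M, IsSelfAdjoint a ∧
      (∀ v, (⟪a v, D (a v)⟫_ℂ).re ≤ s ^ 2 * ‖a v‖ ^ 2) ∧ a * p ≠ 0 := by
    obtain ⟨a, haM, ha, ha1, ha2⟩ := exists_spectral_cut hDM hD (s ^ 2)
    refine ⟨a, haM, ha, ha1, fun h => hv.not_ge (ha2 v ?_)⟩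
    rw [← hpv]
    exact congr($h v)
  have hone : (1 : H →L[ℂ] H) ∈ M := one_mem _
  have hdsa : IsSelfAdjoint d := .of_nonneg hd
  have hQsa (n : ℕ) : IsSelfAdjoint (Q n) := (hQ.isProjection n).1
  have h1sa : IsSelfAdjoint (1 : H →L[ℂ] H) := .one _
  obtain ⟨v₀, hpv₀, hv₀⟩ := hlow m
  obtain ⟨m', hmm', hv₀'⟩ : ∃ m', m < m' ∧
      (⟪v₀, (d + (1 - Q m) + Q m') v₀⟫_ℂ).re < s ^ 2 * ‖v₀‖ ^ 2 := by
    have h1 : Tendsto (fun n => (⟪v₀, (d + (1 - Q m) + Q n) v₀⟫_ℂ).re) atTop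
        (𝓝 ((⟪v₀, (d + (1 - Q m)) v₀ + 0⟫_ℂ).re)) := by
      refine (Complex.continuous_re.tendsto _).comp
        (tendsto_const_nhds.inner ?_)
      exact tendsto_const_nhds.add (hQ.tendsto v₀)
    rw [add_zero] at h1
    exact ((eventually_gt_atTop m).and (h1.eventually (gt_mem_nhds hv₀))).exists
  obtain ⟨a, haM, _, ha, hap⟩ := hcut _ (add_mem (add_mem hdM (sub_mem hone (hQM m))) (hQM m'))
    ((hdsa.add (h1sa.sub (hQsa m))).add (hQsa m')) v₀ hpv₀ hv₀'
  obtain ⟨v₁, hpv₁, hv₁⟩ := hlow m'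
  obtain ⟨b, hbM, hbsa, hb, hbp⟩ := hcut _ (add_mem hdM (sub_mem hone (hQM m')))
    (hdsa.add (h1sa.sub (hQsa m'))) v₁ hpv₁ hv₁
  obtain ⟨t, htM, ht, u, u', hη1, htη, htu⟩ :=
    exists_contraction hpM hp hcen hfac haM hbM hbsa hap hbp
  have hη := hb u
  have hξ := ha u'
  rw [← htu] at hξ
  obtain ⟨η, hηu⟩ : ∃ η, η = b u := ⟨_, rfl⟩
  obtain ⟨ξ, hξu⟩ : ∃ ξ, ξ = t η := ⟨_, rfl⟩
  rw [← hηu] at hη hη1 htη hξ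
  rw [← hξu] at hξ htη
  have hξ1 : ‖ξ‖ ≤ 1 := by rw [hξu, ← hη1]; exact ht η
  have hsum (x y : H →L[ℂ] H) (w : H) : (⟪w, (x + y) w⟫_ℂ).re =
      (⟪w, x w⟫_ℂ).re + (⟪w, y w⟫_ℂ).re := by
    rw [_root_.add_apply, inner_add_right, Complex.add_re]
  have hsq : s ^ 2 * ‖ξ‖ ^ 2 ≤ s ^ 2 := by
    have : ‖ξ‖ ^ 2 ≤ 1 := pow_le_one₀ (norm_nonneg _) hξ1
    nlinarith [sq_nonneg s]
  rw [hη1, one_pow, mul_one, hsum, (hQ.isProjection m').one_sub.re_inner] at hη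
  rw [hsum, hsum, (hQ.isProjection m).one_sub.re_inner,
    (hQ.isProjection m').re_inner] at hξ
  have hdη := re_inner_nonneg hd η
  have hdξ := re_inner_nonneg hd ξ
  have e1 : ‖(1 - Q m) ξ‖ ≤ s := norm_le_of_sq_le hs.le (by nlinarith [sq_nonneg ‖Q m' ξ‖])
  have e2 : ‖Q m' ξ‖ ≤ s := norm_le_of_sq_le hs.le (by nlinarith [sq_nonneg ‖(1 - Q m) ξ‖])
  have e3 : ‖(1 - Q m') η‖ ≤ s := norm_le_of_sq_le hs.le (by linarith)
  obtain ⟨m'', hm'', e4⟩ : ∃ m'', m' < m'' ∧ ‖Q m'' η‖ < s := by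
    have h1 : Tendsto (fun n => ‖Q n η‖) atTop (𝓝 0) := by simpa using (hQ.tendsto η).norm
    exact ((eventually_gt_atTop m').and (h1.eventually (gt_mem_nhds hs))).exists
  have hA : IsProjection (Q m - Q m') := hQ.isProjection_sub hmm'.le
  have hB : IsProjection (Q m' - Q m'') := hQ.isProjection_sub hm''.le
  have hAη : ‖(Q m - Q m') η‖ ≤ s := by
    have : (Q m - Q m') η = (Q m - Q m') ((1 - Q m') η) := by
      have h1 : (Q m - Q m') * (1 - Q m') = Q m - Q m' := by
        rw [mul_sub, mul_one, hQ.sub_mul_of_le hmm'.le le_rfl, sub_zero]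
      exact congr($(h1.symm) η)
    rw [this]
    exact (hA.norm_apply_le _).trans e3
  have hBξ : ‖(Q m' - Q m'') ξ‖ ≤ s := by
    have : (Q m' - Q m'') ξ = (Q m' - Q m'') (Q m' ξ) := by
      have h1 : (Q m' - Q m'') * Q m' = Q m' - Q m'' := by
        rw [sub_mul, (hQ.isProjection m').2, hQ.mul_of_le' hm''.le]
      exact congr($(h1.symm) ξ)
    rw [this]
    exact (hB.norm_apply_le _).trans e2
  have hAv : ‖ξ - (Q m - Q m') (ξ + η)‖ ≤ 3 * s := by
    have : ξ - (Q m - Q m') (ξ + η) = (1 - Q m) ξ + Q m' ξ - (Q m - Q m') η := by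
      simp only [map_add, _root_.sub_apply, one_apply_eq_self]
      abel
    rw [this]
    linarith [norm_sub_le ((1 - Q m) ξ + Q m' ξ) ((Q m - Q m') η),
      norm_add_le ((1 - Q m) ξ) (Q m' ξ)]
  have hBv : ‖η - (Q m' - Q m'') (ξ + η)‖ ≤ 3 * s := by
    have : η - (Q m' - Q m'') (ξ + η) = (1 - Q m') η + Q m'' η - (Q m' - Q m'') ξ := by
      simp only [map_add, _root_.sub_apply, one_apply_eq_self]
      abel
    rw [this]
    linarith [norm_sub_le ((1 - Q m') η + Q m'' η) ((Q m' - Q m'') ξ),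
      norm_add_le ((1 - Q m') η) (Q m'' η)]
  have hv2 : ‖ξ + η‖ ≤ 2 := (norm_add_le _ _).trans (by linarith)
  refine ⟨m', m'', t, ξ + η, hmm', hm'', htM, ht, hv2, ?_, ?_, ?_⟩
  · refine (re_inner_add_le hd ξ η).trans ?_
    nlinarith [sq_nonneg ‖(1 - Q m) ξ‖, sq_nonneg ‖Q m' ξ‖, sq_nonneg ‖(1 - Q m') η‖]
  · have : ξ + η - (Q m - Q m'') (ξ + η) = (ξ - (Q m - Q m') (ξ + η)) +
        (η - (Q m' - Q m'') (ξ + η)) := by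
      simp only [map_add, _root_.sub_apply]
      abel
    rw [this]
    linarith [norm_add_le (ξ - (Q m - Q m') (ξ + η)) (η - (Q m' - Q m'') (ξ + η))]
  · obtain ⟨v, hv⟩ : ∃ v, v = ξ + η := ⟨_, rfl⟩
    rw [← hv] at hAv hBv hv2 ⊢
    have h1 : ⟪v, ((Q m - Q m') * t * (Q m' - Q m'')) v⟫_ℂ =
        ⟪ξ, t η⟫_ℂ - ⟪ξ - (Q m - Q m') v, t ((Q m' - Q m'') v)⟫_ℂ -
          ⟪ξ, t (η - (Q m' - Q m'') v)⟫_ℂ := by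
      rw [mul_apply_eq_comp, mul_apply_eq_comp, ← hA.isSelfAdjoint.inner_left]
      simp only [inner_sub_left, inner_sub_right, map_sub t]
      ring
    have h2 : (⟪ξ, t η⟫_ℂ).re = ‖ξ‖ ^ 2 := by rw [← hξu, re_inner_self]
    have h3 : ‖⟪ξ - (Q m - Q m') v, t ((Q m' - Q m'') v)⟫_ℂ‖ ≤ 3 * s * 2 :=
      (norm_inner_le_norm _ _).trans (mul_le_mul hAv
        ((ht _).trans ((hB.norm_apply_le v).trans hv2)) (norm_nonneg _) (by positivity))
    have h4 : ‖⟪ξ, t (η - (Q m' - Q m'') v)⟫_ℂ‖ ≤ 1 * (3 * s) :=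
      (norm_inner_le_norm _ _).trans (mul_le_mul hξ1 ((ht _).trans hBv) (norm_nonneg _)
        zero_le_one)
    rw [h1, Complex.sub_re, Complex.sub_re, h2]
    have h5 := Complex.re_le_norm ⟪ξ - (Q m - Q m') v, t ((Q m' - Q m'') v)⟫_ℂ
    have h6 := Complex.re_le_norm ⟪ξ, t (η - (Q m' - Q m'') v)⟫_ℂ
    nlinarith

end Blocks

section Transport

variable {M : VonNeumannAlgebra H} {p : H →L[ℂ] H}

theorem IsVanishing.comp {Q : ℕ → H →L[ℂ] H} (hQ : IsVanishing Q) {μ : ℕ → ℕ}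
    (hμ : StrictMono μ) : IsVanishing (fun k => Q (μ k)) where
  isProjection _ := hQ.isProjection _
  mul_of_le _ _ h := hQ.mul_of_le _ _ (hμ.monotone h)
  tendsto v := (hQ.tendsto v).comp hμ.tendsto_atTop

theorem le_re_inner_of_block {R y : H →L[ℂ] H} (hR : IsProjection R) (hy : ∀ w, ‖y w‖ ≤ ‖w‖)
    {s : ℝ} (hs : 0 < s) (hs' : s ≤ 1 / 1000) {u : H} (hu : ‖u‖ ≤ 2) (hRu : ‖u - R u‖ ≤ 6 * s)
    (h : 1 / 4 - 9 * s ≤ (⟪u, (R * y * R) u⟫_ℂ).re) : 1 / 8 ≤ (⟪u, y u⟫_ℂ).re := by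
  rw [mul_assoc, mul_apply_eq_comp, ← hR.isSelfAdjoint.inner_left, mul_apply_eq_comp] at h
  obtain ⟨w, hw⟩ : ∃ w, w = R u := ⟨_, rfl⟩
  have hwn : ‖w‖ ≤ 2 := by rw [hw]; exact (hR.norm_apply_le u).trans hu
  rw [← hw] at h hRu
  have h4 : ⟪w, y w⟫_ℂ = ⟪u, y u⟫_ℂ - ⟪u - w, y u⟫_ℂ - ⟪w, y (u - w)⟫_ℂ := by
    simp only [inner_sub_left, inner_sub_right, map_sub]
    ring
  have h5 : ‖⟪u - w, y u⟫_ℂ‖ ≤ 6 * s * 2 := (norm_inner_le_norm _ _).trans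
    (mul_le_mul hRu ((hy u).trans hu) (norm_nonneg _) (by positivity))
  have h6 : ‖⟪w, y (u - w)⟫_ℂ‖ ≤ 2 * (6 * s) := (norm_inner_le_norm _ _).trans
    (mul_le_mul hwn ((hy _).trans hRu) (norm_nonneg _) (by norm_num))
  have h7 := (abs_le.1 (Complex.abs_re_le_norm ⟪u - w, y u⟫_ℂ)).1
  have h8 := (abs_le.1 (Complex.abs_re_le_norm ⟪w, y (u - w)⟫_ℂ)).1
  rw [h4, Complex.sub_re, Complex.sub_re] at h
  linarith

/-- Summing up the blocks: an off-diagonal contraction detected by a sequence of vectors which are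
almost annihilated by the given positive operators. -/
theorem exists_transport (hpM : p ∈ M) (hp : IsProjection p) (hcen : ∀ x ∈ M, p * x = x * p)
    (hfac : CornerIsFactor M p) {Q : ℕ → H →L[ℂ] H} (hQ : IsVanishing Q) (hQM : ∀ n, Q n ∈ M)
    {d : ℕ → H →L[ℂ] H} (hdM : ∀ k, d k ∈ M) (hd : ∀ k, 0 ≤ d k) {s : ℕ → ℝ} (hs : ∀ k, 0 < s k)
    (hs' : ∀ k, s k ≤ 1 / 1000)
    (hlow : ∀ k m, ∃ v, p v = v ∧
      (⟪v, (d k + (1 - Q m)) v⟫_ℂ).re < s k ^ 2 * ‖v‖ ^ 2) :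
    ∃ (P y : H →L[ℂ] H) (v : ℕ → H), IsProjection P ∧
      (∀ C : VonNeumannAlgebra H, (∀ n, Q n ∈ C) → P ∈ C) ∧ y ∈ M ∧ P * y = y ∧ y * P = 0 ∧
      ∀ k, ‖v k‖ ≤ 2 ∧ 1 / 8 ≤ ‖v k‖ ^ 2 ∧ (⟪v k, d k (v k)⟫_ℂ).re ≤ 4 * s k ^ 2 ∧
        1 / 8 ≤ (⟪v k, y (v k)⟫_ℂ).re := by
  choose m' m'' t v hm' hm'' htM ht hv2 hvd hvR hvt using fun k m =>
    exists_block hpM hp hcen hfac hQ hQM (hdM k) (hd k) (hs k) (hlow k) m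
  let μ : ℕ → ℕ := fun k => Nat.rec 0 (fun k m => m'' k m) k
  have hμs (k : ℕ) : μ (k + 1) = m'' k (μ k) := rfl
  have hμ : StrictMono μ := strictMono_nat_of_lt_succ fun k => by
    rw [hμs]
    exact (hm' k _).trans (hm'' k _)
  have hR := hQ.comp hμ
  let A (k : ℕ) : H →L[ℂ] H := Q (μ k) - Q (m' k (μ k))
  let B (k : ℕ) : H →L[ℂ] H := Q (m' k (μ k)) - Q (μ (k + 1))
  have hA (k : ℕ) : IsProjection (A k) := hQ.isProjection_sub (hm' k _).le
  have hB (k : ℕ) : IsProjection (B k) := hQ.isProjection_sub (hm'' k _).le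
  have hBA (k : ℕ) : B k * A k = 0 := by
    have h1 := (hm' k (μ k)).le
    have h2 : m' k (μ k) ≤ μ (k + 1) := (hm'' k (μ k)).le
    simp only [A, B, sub_mul]
    rw [hQ.mul_sub_of_le h1 le_rfl, hQ.mul_sub_of_le h1 h2, sub_self]
  have hE (k : ℕ) : Q (μ k) - Q (μ (k + 1)) = A k + B k := by simp [A, B]
  have hAB (k : ℕ) : A k * B k = 0 := by
    have := congr_arg star (hBA k)
    rwa [star_mul, (hA k).1, (hB k).1, star_zero] at this
  have hAz : IsBlockSeq (fun k => Q (μ k)) A :=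
    { block := fun k => by
        rw [hE, add_mul, (hA k).2, hBA, add_zero, mul_add, (hA k).2, hAB, add_zero]
      norm_le := fun k => (hA k).norm_apply_le }
  let z (k : ℕ) : H →L[ℂ] H := A k * t k (μ k) * B k
  have hzz (k : ℕ) : A k * z k = z k := by
    simp only [z]
    rw [← mul_assoc, ← mul_assoc, (hA k).2]
  have hz : IsBlockSeq (fun k => Q (μ k)) z :=
    { block := fun k => by
        rw [hE, add_mul, hzz]
        simp only [z]
        rw [← mul_assoc, ← mul_assoc, hBA, zero_mul, zero_mul, add_zero, mul_add, mul_assoc _ (B k),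
          mul_assoc _ (B k), hBA, (hB k).2, mul_zero, zero_add]
      norm_le := fun k w => ((hA k).norm_apply_le _).trans
        ((ht k _ _).trans ((hB k).norm_apply_le _)) }
  have h0 : IsStrongSum (fun _ => 0) (0 : H →L[ℂ] H) := fun w => by simp
  obtain ⟨P, hP⟩ := hAz.exists_isStrongSum hR
  obtain ⟨y, hy⟩ := hz.exists_isStrongSum hR
  have hyn := hz.norm_apply_le_of_isStrongSum hR hy
  refine ⟨P, y, fun k => v k (μ k),
    ⟨hP.isSelfAdjoint fun k => (hA k).1,
      hAz.mul_eq_of_isStrongSum hR hAz (fun k => (hA k).2) hP hP hP⟩,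
    fun C hC => hP.mem fun k => sub_mem (hC _) (hC _),
    hy.mem fun k => mul_mem (mul_mem (sub_mem (hQM _) (hQM _)) (htM _ _))
      (sub_mem (hQM _) (hQM _)),
    hAz.mul_eq_of_isStrongSum hR hz hzz hP hy hy,
    hz.mul_eq_of_isStrongSum hR hAz (fun k => ?_) hy hP h0, fun k => ?_⟩
  · simp only [z]
    rw [mul_assoc, hBA, mul_zero]
  · have hk : 1 / 8 ≤ (⟪v k (μ k), y (v k (μ k))⟫_ℂ).re := by
      refine le_re_inner_of_block (hR.isProjection_sub k.le_succ) hyn (hs k) (hs' k) (hv2 _ _)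
        (hvR k (μ k)) ?_
      rw [hz.block_of_isStrongSum hR hy k]
      exact hvt k (μ k)
    refine ⟨hv2 _ _, hk.trans ?_, hvd _ _, hk⟩
    refine (Complex.re_le_norm _).trans ((norm_inner_le_norm _ _).trans ?_)
    rw [sq]
    exact mul_le_mul_of_nonneg_left (hyn _) (norm_nonneg _)

end Transport

section SelfAdjointPart

/-- The real vector space of self-adjoint elements of a von Neumann algebra. -/
def saPart (M : VonNeumannAlgebra H) : Submodule ℝ (H →L[ℂ] H) where
  carrier := {x | x ∈ M ∧ IsSelfAdjoint x}
  add_mem' hx hy := ⟨add_mem hx.1 hy.1, hx.2.add hy.2⟩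
  zero_mem' := ⟨zero_mem M, .zero _⟩
  smul_mem' r _ hx := ⟨real_smul_mem hx.1 r, (IsSelfAdjoint.all r).smul hx.2⟩

/-- The positive cone of a von Neumann algebra. -/
def saCone (M : VonNeumannAlgebra H) : PointedCone ℝ (saPart M) where
  carrier := {x | 0 ≤ (x : H →L[ℂ] H)}
  add_mem' hx hy := add_nonneg (α := H →L[ℂ] H) hx hy
  zero_mem' := le_refl (0 : H →L[ℂ] H)
  smul_mem' r _ hx := smul_nonneg (α := ℝ) (β := H →L[ℂ] H) r.2 hx

/-- The unit as a self-adjoint element. -/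
def saOne (M : VonNeumannAlgebra H) : saPart M := ⟨1, one_mem M, .one _⟩

variable {M : VonNeumannAlgebra H} {p : H →L[ℂ] H}

theorem mem_saCone {x : saPart M} : x ∈ saCone M ↔ 0 ≤ (x : H →L[ℂ] H) := Iff.rfl

theorem isOrderUnit_saOne : IsOrderUnit (saCone M) (saOne M) := by
  refine ⟨mem_saCone.2 (zero_le_one (α := H →L[ℂ] H)), fun x => ⟨‖(x : H →L[ℂ] H)‖, ?_⟩⟩
  rw [mem_saCone]
  have := IsSelfAdjoint.le_algebraMap_norm_self (a := (x : H →L[ℂ] H)) x.2.2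
  rw [Algebra.algebraMap_eq_smul_one] at this
  exact sub_nonneg.2 this

/-- The normalised vector state given by `v`, on self-adjoint elements. -/
noncomputable def vectorState (M : VonNeumannAlgebra H) (v : H) : saPart M →ₗ[ℝ] ℝ where
  toFun x := (⟪v, (x : H →L[ℂ] H) v⟫_ℂ).re / ‖v‖ ^ 2
  map_add' x y := by simp [add_div]
  map_smul' r x := by
    change (⟪v, r • (x : H →L[ℂ] H) v⟫_ℂ).re / ‖v‖ ^ 2 = r * _
    rw [re_inner_real_smul, mul_div_assoc]

theorem vectorState_apply (v : H) (x : saPart M) :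
    vectorState M v x = (⟪v, (x : H →L[ℂ] H) v⟫_ℂ).re / ‖v‖ ^ 2 := rfl

theorem vectorState_mem {v : H} (hv : v ≠ 0) :
    ⇑(vectorState M v) ∈ orderStates (saCone M) (saOne M) := by
  refine ⟨⟨_, rfl⟩, fun x hx => div_nonneg (re_inner_nonneg hx v) (by positivity), ?_⟩
  have : ‖v‖ ^ 2 ≠ 0 := by positivity
  change (⟪v, v⟫_ℂ).re / ‖v‖ ^ 2 = 1
  rw [re_inner_self, div_self this]

theorem orderState_mono {φ : saPart M → ℝ} (hφ : φ ∈ orderStates (saCone M) (saOne M))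
    {x y : saPart M} (h : (x : H →L[ℂ] H) ≤ y) : φ x ≤ φ y := by
  obtain ⟨⟨f, rfl⟩, h0, -⟩ := hφ
  have := h0 (y - x) (mem_saCone.2 (sub_nonneg.2 h))
  rw [map_sub] at this
  linarith

/-- A state supported by a central projection `p` dominates the infimum of the numerical range of
`D` on the range of `p`. -/
theorem exists_re_inner_lt {φ : saPart M → ℝ} (hφ : φ ∈ orderStates (saCone M) (saOne M))
    (hp : IsProjection p) (hcen : ∀ x ∈ M, p * x = x * p) {pS : saPart M}
    (hpS : (pS : H →L[ℂ] H) = p) (hφp : φ pS = 1) {D : saPart M} (hD : 0 ≤ (D : H →L[ℂ] H)) {c : ℝ}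
    (hc : φ D < c) : ∃ v, p v = v ∧ (⟪v, (D : H →L[ℂ] H) v⟫_ℂ).re < c * ‖v‖ ^ 2 := by
  by_contra! h
  have hle : ((c • pS : saPart M) : H →L[ℂ] H) ≤ D := by
    rw [← sub_nonneg, nonneg_iff_re_inner (D.2.2.sub (c • pS).2.2)]
    intro v
    have hcomm : p * D = D * p := hcen _ D.2.1
    have h1 : (D : H →L[ℂ] H) (p v) = p ((D : H →L[ℂ] H) v) := congr($(hcomm.symm) v)
    have h2 := re_inner_nonneg hD (v - p v)
    have h3 := h (p v) (hp.apply_apply v)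
    have h4 : ⟪v - p v, (D : H →L[ℂ] H) (v - p v)⟫_ℂ = ⟪v, (D : H →L[ℂ] H) v⟫_ℂ -
        ⟪p v, (D : H →L[ℂ] H) (p v)⟫_ℂ := by
      rw [map_sub, h1, inner_sub_left, inner_sub_right, inner_sub_right,
        hp.isSelfAdjoint.inner_left, hp.isSelfAdjoint.inner_left, hp.apply_apply]
      ring
    have h5 : (⟪v, ((D : H →L[ℂ] H) - ((c • pS : saPart M) : H →L[ℂ] H)) v⟫_ℂ).re =
        (⟪v, (D : H →L[ℂ] H) v⟫_ℂ).re - c * ‖p v‖ ^ 2 := by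
      rw [Submodule.coe_smul, hpS, _root_.sub_apply, inner_sub_right, Complex.sub_re,
        _root_.smul_apply, re_inner_real_smul, hp.re_inner]
    rw [h4, Complex.sub_re] at h2
    rw [h5]
    linarith
  have h1 := orderState_mono hφ hle
  obtain ⟨⟨f, rfl⟩, -⟩ := hφ
  rw [map_smul, hφp, smul_eq_mul, mul_one] at h1
  linarith

/-- The property of a state `φ` ruling out that it is multiplicative and non-normal on a von Neumann
subalgebra containing the vanishing sequence `Q`. -/
def BreaksSequence (M : VonNeumannAlgebra H) (Q : ℕ → H →L[ℂ] H) (φ : saPart M → ℝ) : Prop :=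
  (∃ n, ∃ x : saPart M, (x : H →L[ℂ] H) = Q n ∧ φ x ≠ 1) ∨
    ∃ P y : H →L[ℂ] H, IsProjection P ∧ (∀ C : VonNeumannAlgebra H, (∀ n, Q n ∈ C) → P ∈ C) ∧
      y ∈ M ∧ P * y = y ∧ y * P = 0 ∧
      ∃ X : saPart M, (X : H →L[ℂ] H) = y + star y ∧ φ X ≠ 0

/-- The limit along a sequence of vector states of an off-diagonal contraction. -/
theorem exists_state_ne_zero (hpM : p ∈ M) (hp : IsProjection p)
    (hcen : ∀ x ∈ M, p * x = x * p) (hfac : CornerIsFactor M p) {Q : ℕ → H →L[ℂ] H}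
    (hQ : IsVanishing Q) (hQM : ∀ n, Q n ∈ M) {g : saPart M →ₗ[ℝ] ℝ}
    (hg : ⇑g ∈ (orderStates (saCone M) (saOne M)).extremePoints ℝ)
    (hgp : g ⟨p, hpM, hp.1⟩ = 1) (hgQ : ∀ n, g ⟨Q n, hQM n, (hQ.isProjection n).1⟩ = 1)
    {D : Set (saPart M × ℝ)} (hD : D.Countable)
    (hgD : ⇑g ∈ orderStatesCut (saCone M) (saOne M) D) :
    ∃ P y : H →L[ℂ] H, IsProjection P ∧ (∀ C : VonNeumannAlgebra H, (∀ n, Q n ∈ C) → P ∈ C) ∧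
      y ∈ M ∧ P * y = y ∧ y * P = 0 ∧ ∃ X : saPart M, (X : H →L[ℂ] H) = y + star y ∧
      ∃ h ∈ orderStatesCut (saCone M) (saOne M) D, 0 < h X := by
  obtain ⟨x, hx⟩ := Set.countable_iff_exists_subset_range.1 (hD.image Prod.fst)
  let s (k : ℕ) : ℝ := 1 / 1000 * (1 / ((k : ℝ) + 1))
  have hs (k : ℕ) : 0 < s k := by positivity
  have hs' (k : ℕ) : s k ≤ 1 / 1000 := by
    have : 1 / ((k : ℝ) + 1) ≤ 1 := by
      rw [div_le_one (by positivity)]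
      linarith [k.cast_nonneg (α := ℝ)]
    simp only [s]
    linarith
  have hs0 : Tendsto s atTop (𝓝 0) := by
    have := (tendsto_one_div_add_atTop_nhds_zero_nat (𝕜 := ℝ)).const_mul (1 / 1000)
    rwa [mul_zero] at this
  classical
  choose d hdC hdx hgd using fun k => exists_dominating_finset isOrderUnit_saOne hg
    ((Finset.range (k + 1)).image x) (pow_pos (hs k) 2)
  have hlow (k m : ℕ) : ∃ v, p v = v ∧
      (⟪v, ((d k : H →L[ℂ] H) + (1 - Q m)) v⟫_ℂ).re < s k ^ 2 * ‖v‖ ^ 2 := by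
    let q : saPart M := ⟨Q m, hQM m, (hQ.isProjection m).1⟩
    have h1 : (0 : H →L[ℂ] H) ≤ 1 - Q m := (hQ.isProjection m).one_sub.nonneg
    refine exists_re_inner_lt hg.1 hp hcen (pS := ⟨p, hpM, hp.1⟩) rfl hgp
      (D := d k + (saOne M - q)) (add_nonneg (hdC k) h1) ?_
    rw [map_add, map_sub, hgQ m, hg.1.2.2, sub_self, add_zero]
    exact hgd k
  obtain ⟨P, y, v, hP, hPC, hyM, hPy, hyP, hv⟩ := exists_transport hpM hp hcen hfac hQ hQM
    (fun k => (d k).2.1) (fun k => hdC k) hs hs' hlow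
  have hv0 (k : ℕ) : 0 < ‖v k‖ ^ 2 := by linarith [(hv k).2.1]
  have hvne (k : ℕ) : v k ≠ 0 := fun h => by simpa [h] using hv0 k
  refine ⟨P, y, hP, hPC, hyM, hPy, hyP, ⟨y + star y, add_mem hyM (star_mem hyM),
    .add_star_self y⟩, rfl, ?_⟩
  have hcpt := isCompact_orderStatesCut (isOrderUnit_saOne (M := M)) ∅
  rw [orderStatesCut_empty] at hcpt
  obtain ⟨h, hh, hlim⟩ := hcpt.ultrafilter_le_nhds
    ((hyperfilter ℕ).map fun k => ⇑(vectorState M (v k)))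
    (le_principal_iff.2 (Filter.mem_map.2 (Filter.univ_mem' fun k => vectorState_mem (hvne k))))
  have hlim' := tendsto_pi_nhds.1 (show Tendsto (fun k => ⇑(vectorState M (v k)))
    (hyperfilter ℕ) (𝓝 h) from hlim)
  refine ⟨h, ⟨hh, fun c hc => ?_⟩, ?_⟩
  · rw [← hgD.2 c hc]
    obtain ⟨j, hj⟩ := hx ⟨c, hc, rfl⟩
    rw [← hj]
    refine tendsto_nhds_unique (hlim' (x j)) (Tendsto.mono_left ?_ Nat.hyperfilter_le_atTop)
    refine tendsto_iff_norm_sub_tendsto_zero.2 ?_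
    have hb : Tendsto (fun k => 32 * s k ^ 2) atTop (𝓝 0) := by
      simpa using (hs0.pow 2).const_mul 32
    refine squeeze_zero' (.of_forall fun k => norm_nonneg _) ?_ hb
    filter_upwards [eventually_ge_atTop j] with k hk
    obtain ⟨h1, h2⟩ := hdx k (x j) (Finset.mem_image_of_mem _ (Finset.mem_range.2 (by omega)))
    have hvs := vectorState_mem (M := M) (hvne k)
    have h3 := hvs.2.1 _ h1
    have h4 := hvs.2.1 _ h2
    rw [map_sub, map_sub, map_smul, hvs.2.2, smul_eq_mul, mul_one] at h3
    rw [map_add, map_sub, map_smul, hvs.2.2, smul_eq_mul, mul_one] at h4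
    have h5 : vectorState M (v k) (d k) ≤ 32 * s k ^ 2 := by
      rw [vectorState_apply, div_le_iff₀ (hv0 k)]
      nlinarith [(hv k).2.2.1, (hv k).2.1, sq_nonneg (s k)]
    rw [Real.norm_eq_abs, abs_le]
    constructor <;> linarith
  · refine lt_of_lt_of_le (b := 1 / 16) (by norm_num)
      (ge_of_tendsto (hlim' _) (.of_forall fun k => ?_))
    rw [vectorState_apply, le_div_iff₀ (hv0 k)]
    have h1 : (⟪v k, (y + star y) (v k)⟫_ℂ).re = 2 * (⟪v k, y (v k)⟫_ℂ).re := by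
      rw [_root_.add_apply, inner_add_right, ContinuousLinearMap.star_eq_adjoint,
        ContinuousLinearMap.adjoint_inner_right, Complex.add_re, ← inner_conj_symm (y (v k)),
        Complex.conj_re]
      ring
    change _ ≤ (⟪v k, (y + star y) (v k)⟫_ℂ).re
    rw [h1]
    have h2 : ‖v k‖ ^ 2 ≤ 2 ^ 2 := pow_le_pow_left₀ (norm_nonneg _) (hv k).1 2
    linarith [(hv k).2.2.2]

theorem exists_breaking_element (hpM : p ∈ M) (hp : IsProjection p)
    (hcen : ∀ x ∈ M, p * x = x * p) (hfac : CornerIsFactor M p) {Q : ℕ → H →L[ℂ] H}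
    (hQ : IsVanishing Q) (hQM : ∀ n, Q n ∈ M) {D : Set (saPart M × ℝ)} (hD : D.Countable)
    (hne : (orderStatesCut (saCone M) (saOne M) D).Nonempty)
    (hext : IsExtreme ℝ (orderStates (saCone M) (saOne M)) (orderStatesCut (saCone M) (saOne M) D))
    (hDp : ∀ φ ∈ orderStatesCut (saCone M) (saOne M) D, φ ⟨p, hpM, hp.1⟩ = 1) :
    ∃ x : saPart M, ∀ φ ∈ orderStatesCut (saCone M) (saOne M) D,
      (∀ ψ ∈ orderStatesCut (saCone M) (saOne M) D, ψ x ≤ φ x) → BreaksSequence M Q φ := by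
  let QS (n : ℕ) : saPart M := ⟨Q n, hQM n, (hQ.isProjection n).1⟩
  have hsub {φ : saPart M → ℝ} (hφ : φ ∈ orderStatesCut (saCone M) (saOne M) D) (n : ℕ) :
      φ (saOne M - QS n) = 1 - φ (QS n) := by
    obtain ⟨⟨⟨f, rfl⟩, -, h1⟩, -⟩ := hφ
    rw [map_sub, h1]
  by_cases hcase : ∃ φ ∈ orderStatesCut (saCone M) (saOne M) D, ∃ n, φ (QS n) ≠ 1
  · obtain ⟨φ, hφ, n, hn⟩ := hcase
    refine ⟨saOne M - QS n, fun ψ hψ hmax => .inl ⟨n, QS n, rfl, fun h1 => hn ?_⟩⟩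
    have h2 := hmax φ hφ
    have h3 := hφ.1.2.1 (saOne M - QS n) (hQ.isProjection n).one_sub.nonneg
    rw [hsub hφ] at h3 h2
    rw [hsub hψ, h1] at h2
    linarith
  · push Not at hcase
    obtain ⟨g, hg⟩ := (isCompact_orderStatesCut isOrderUnit_saOne D).extremePoints_nonempty
      hne
    have hg' := hext.extremePoints_subset_extremePoints hg
    obtain ⟨⟨⟨g, rfl⟩, -⟩, -⟩ := hg.1
    obtain ⟨P, y, hP, hPC, hyM, hPy, hyP, X, hX, h, hh, hhX⟩ := exists_state_ne_zero hpM hp hcen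
      hfac hQ hQM hg' (hDp _ hg.1) (hcase _ hg.1) hD hg.1
    exact ⟨X, fun φ hφ hmax => .inr ⟨P, y, hP, hPC, hyM, hPy, hyP, X, hX,
      (hhX.trans_le (hmax h hh)).ne'⟩⟩

end SelfAdjointPart

section Complexification

variable {M : VonNeumannAlgebra H}

/-- Self-adjoint elements of the algebra `M`, as elements of `saPart M`. -/
def saPartOf (M : VonNeumannAlgebra H) : selfAdjoint ↥M →ₗ[ℝ] saPart M where
  toFun x := ⟨((x : ↥M) : H →L[ℂ] H), (x : ↥M).2, congr_arg Subtype.val x.2.star_eq⟩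
  map_add' _ _ := rfl
  map_smul' _ _ := rfl

/-- The complex-linear extension of a real functional on the self-adjoint part. -/
noncomputable def complexify (φ : saPart M →ₗ[ℝ] ℝ) : ↥M →ₗ[ℂ] ℂ where
  toFun x := (φ (saPartOf M (ℜ x)) : ℂ) + Complex.I * φ (saPartOf M (ℑ x))
  map_add' x y := by
    simp only [map_add, Complex.ofReal_add]
    ring
  map_smul' c x := by
    have h1 : φ (saPartOf M (ℜ (c • x))) =
        c.re * φ (saPartOf M (ℜ x)) - c.im * φ (saPartOf M (ℑ x)) := by
      rw [realPart_smul, LinearMap.map_sub, LinearMap.map_smul, LinearMap.map_smul,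
        LinearMap.map_sub, LinearMap.map_smul, LinearMap.map_smul, smul_eq_mul, smul_eq_mul]
    have h2 : φ (saPartOf M (ℑ (c • x))) =
        c.re * φ (saPartOf M (ℑ x)) + c.im * φ (saPartOf M (ℜ x)) := by
      rw [imaginaryPart_smul, LinearMap.map_add, LinearMap.map_smul, LinearMap.map_smul,
        LinearMap.map_add, LinearMap.map_smul, LinearMap.map_smul, smul_eq_mul, smul_eq_mul]
    rw [h1, h2, RingHom.id_apply, smul_eq_mul]
    conv_rhs => rw [← Complex.re_add_im c]
    push_cast
    linear_combination (-(c.im : ℂ) * φ (saPartOf M (ℑ x))) * Complex.I_sq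

theorem complexify_of_isSelfAdjoint (φ : saPart M →ₗ[ℝ] ℝ) {x : ↥M}
    (hx : IsSelfAdjoint (x : H →L[ℂ] H)) : complexify φ x = φ ⟨x, x.2, hx⟩ := by
  have hx' : IsSelfAdjoint x := Subtype.ext hx
  have h1 : saPartOf M (ℜ x) = ⟨x, x.2, hx⟩ :=
    Subtype.ext (congr_arg (fun y : ↥M => (y : H →L[ℂ] H)) hx'.coe_realPart)
  change (φ (saPartOf M (ℜ x)) : ℂ) + Complex.I * φ (saPartOf M (ℑ x)) = _
  rw [h1, hx'.imaginaryPart]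
  simp

theorem functional_ext_of_isSelfAdjoint {f g : ↥M →ₗ[ℂ] ℂ}
    (h : ∀ x : ↥M, IsSelfAdjoint (x : H →L[ℂ] H) → f x = g x) : f = g := by
  ext x
  rw [← realPart_add_I_smul_imaginaryPart x, map_add, map_add, map_smul, map_smul,
    h (ℜ x : ↥M) (congr_arg Subtype.val (ℜ x).2.star_eq),
    h (ℑ x : ↥M) (congr_arg Subtype.val (ℑ x).2.star_eq)]

/-- The real part of a functional, restricted to the self-adjoint part. -/
noncomputable def reRestrict (g : ↥M →ₗ[ℂ] ℂ) : saPart M →ₗ[ℝ] ℝ where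
  toFun x := (g ⟨x, x.2.1⟩).re
  map_add' x y := by
    rw [← Complex.add_re, ← map_add]
    rfl
  map_smul' r x := by
    have h1 : (⟨((r • x : saPart M) : H →L[ℂ] H), (r • x).2.1⟩ : ↥M) =
        (r : ℂ) • ⟨x, x.2.1⟩ := rfl
    rw [h1, map_smul, smul_eq_mul, Complex.re_ofReal_mul]
    rfl

theorem isStateOn_complexify {φ : saPart M →ₗ[ℝ] ℝ}
    (hφ : ⇑φ ∈ orderStates (saCone M) (saOne M)) : IsStateOn M (complexify φ) := by
  refine ⟨isPosFunctional_iff.2 fun x hx => ?_, ?_⟩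
  · rw [complexify_of_isSelfAdjoint φ (.of_nonneg hx)]
    exact Complex.zero_le_real.2 (hφ.2.1 _ hx)
  · rw [complexify_of_isSelfAdjoint φ (x := 1) (.one (H →L[ℂ] H))]
    exact_mod_cast hφ.2.2

theorem isPureStateOn_complexify {φ : saPart M →ₗ[ℝ] ℝ}
    (hφ : ⇑φ ∈ (orderStates (saCone M) (saOne M)).extremePoints ℝ) :
    IsPureStateOn M (complexify φ) := by
  refine ⟨isStateOn_complexify hφ.1, fun g hg hfg => ?_⟩
  have hg0 (x : saPart M) (hx : x ∈ saCone M) : 0 ≤ reRestrict g x :=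
    (Complex.le_def.1 (hg.nonneg (x := ⟨x, x.2.1⟩) hx)).1
  have hgφ (x : saPart M) (hx : x ∈ saCone M) : reRestrict g x ≤ φ x := by
    have h1 := (Complex.le_def.1 (hfg.nonneg (x := ⟨x, x.2.1⟩) hx)).1
    rw [LinearMap.sub_apply, complexify_of_isSelfAdjoint φ (x := ⟨x, x.2.1⟩) x.2.2,
      Complex.sub_re, Complex.ofReal_re, Complex.zero_re] at h1
    exact sub_nonneg.1 h1
  obtain ⟨t, ht, hgt⟩ := eq_smul_of_le_extreme isOrderUnit_saOne hφ (reRestrict g) hg0 hgφ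
  refine ⟨t, ht, functional_ext_of_isSelfAdjoint fun x hx => ?_⟩
  have h1 : (g x).re = t * φ ⟨x, x.2, hx⟩ := LinearMap.congr_fun hgt ⟨x, x.2, hx⟩
  rw [LinearMap.smul_apply, complexify_of_isSelfAdjoint φ hx, smul_eq_mul, ← Complex.ofReal_mul,
    ← h1]
  exact Complex.ext (Complex.ofReal_re _).symm
    ((hg.im_eq_zero (Subtype.ext hx)).trans (Complex.ofReal_im _).symm)

/-- A pure state which is not normal is singular. -/
theorem IsPureStateOn.isSingularOn {f : ↥M →ₗ[ℂ] ℂ} (hf : IsPureStateOn M f)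
    (hn : ¬ IsNormalOn M f) : IsSingularOn M f := by
  intro g hg hfg hgn
  obtain ⟨t, -, rfl⟩ := hf.2 g hg hfg
  by_cases ht : (t : ℂ) = 0
  · rw [ht, zero_smul]
  refine absurd ?_ hn
  have h1 : f = (t : ℂ)⁻¹ • (t : ℂ) • f := by rw [smul_smul, inv_mul_cancel₀ ht, one_smul]
  rw [h1]
  unfold IsNormalOn at hgn ⊢
  exact @Continuous.const_smul _ _ _ _ _ _ (_) _ hgn _

theorem isClassicallyNormalOn_of_forall_breaksSequence [TopologicalSpace.SeparableSpace H]
    {φ : saPart M →ₗ[ℝ] ℝ} (hφ : ⇑φ ∈ orderStates (saCone M) (saOne M))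
    (h : ∀ Q : ℕ → H →L[ℂ] H, (∀ n, Q n ∈ M) → IsVanishing Q → BreaksSequence M Q φ) :
    IsClassicallyNormalOn M (complexify φ) := by
  intro C hC hmul
  have hf := isStateOn_complexify hφ
  rcases exists_eigenvector_or_isVanishing hC hf hmul with ⟨v, hv1, hv⟩ | ⟨Q, hQC, hQ, hfQ⟩
  · exact isNormalOnSub_of_eigenvector hC hv1 hv
  exfalso
  rcases h _ (fun n => (Q n).2) hQ with ⟨n, x, hx, hne⟩ | ⟨P, y, hP, hPC, hyM, hPy, hyP, X, hX, hne⟩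
  · have h1 := hfQ n
    have hsa : IsSelfAdjoint (Q n : H →L[ℂ] H) := by
      have hx' : (x : H →L[ℂ] H) = Q n := hx
      exact hx' ▸ x.2.2
    rw [complexify_of_isSelfAdjoint φ hsa] at h1
    apply hne
    have h2 : x = ⟨Q n, (Q n).2, hsa⟩ := Subtype.ext hx
    rw [h2]
    exact_mod_cast h1
  · have hPinC := hPC C hQC
    let P' : ↥M := ⟨P, hC hPinC⟩
    let y' : ↥M := ⟨y, hyM⟩
    have hPP : P' * P' = P' := Subtype.ext hP.2
    have hPs : star P' = P' := Subtype.ext hP.1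
    have hPy' : P' * y' = y' := Subtype.ext hPy
    have hyP' : y' * (1 - P') = y' := by
      have : y' * P' = 0 := Subtype.ext hyP
      rw [mul_sub, mul_one, this, sub_zero]
    have hfy : complexify φ y' = 0 := by
      have h1 := hmul P' P' hPinC hPinC
      rw [hPP] at h1
      have h2 : complexify φ P' * (1 - complexify φ P') = 0 := by rw [mul_sub, ← h1]; ring
      rcases mul_eq_zero.1 h2 with h0 | h0
      · rw [← hPy']
        exact hf.1.mul_eq_zero_left (by rw [hPs, hPP, h0]) _
      · rw [← hyP']
        refine hf.1.mul_eq_zero_right ?_ _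
        have h3 : star (1 - P') * (1 - P') = 1 - P' := by
          rw [star_sub, star_one, hPs, mul_sub, mul_one, sub_mul, one_mul, hPP, sub_self, sub_zero]
        rw [h3, map_sub, hf.2, h0]
    have hfX : complexify φ (y' + star y') = 0 := by
      rw [map_add, hf.1.map_star, hfy, star_zero, add_zero]
    have hsa : IsSelfAdjoint ((y' + star y' : ↥M) : H →L[ℂ] H) := IsSelfAdjoint.add_star_self y
    rw [complexify_of_isSelfAdjoint φ hsa] at hfX
    apply hne
    have h2 : X = ⟨(y' + star y' : ↥M), (y' + star y').2, hsa⟩ := Subtype.ext hX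
    rw [h2]
    exact_mod_cast hfX

end Complexification

section Construction

open Cardinal in
/-- Under the continuum hypothesis the sequences of operators on a separable Hilbert space are
enumerated by a well order with countable initial segments. -/
theorem exists_enumeration [TopologicalSpace.SeparableSpace H]
    (CH : (2 : Cardinal.{0}) ^ Cardinal.aleph0 = Cardinal.aleph 1) :
    ∃ (ι : Type) (_ : LinearOrder ι) (_ : WellFoundedLT ι) (e : ι → ℕ → H →L[ℂ] H),
      (∀ i : ι, (Set.Iio i).Countable) ∧ Function.Surjective e := by
  let F : (ℕ → H →L[ℂ] H) → ℕ → ℕ → ℕ → ℂ := fun T i j k =>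
    ⟪TopologicalSpace.denseSeq H j, T i (TopologicalSpace.denseSeq H k)⟫_ℂ
  have hF : Function.Injective F := by
    intro T T' h
    funext i
    refine ContinuousLinearMap.coeFn_injective ?_
    refine (TopologicalSpace.denseRange_denseSeq H).equalizer (T i).continuous (T' i).continuous ?_
    funext k
    refine (TopologicalSpace.denseRange_denseSeq H).eq_of_inner_right ℂ fun j => ?_
    exact congr_fun (congr_fun (congr_fun h i) j) k
  have hcard : #(ℕ → ℕ → ℕ → ℂ) = #((aleph 1 : Cardinal.{0}).ord.ToType) := by
    rw [mk_ord_toType, ← CH]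
    simp
  obtain ⟨E⟩ := Cardinal.eq.1 hcard
  refine ⟨(aleph 1 : Cardinal.{0}).ord.ToType, inferInstance, inferInstance,
    Function.invFun (E ∘ F), fun i => ?_, Function.invFun_surjective (E.injective.comp hF)⟩
  rw [← le_aleph0_iff_set_countable, ← lt_aleph_one_iff]
  simpa using mk_Iio_lt i

variable {M : VonNeumannAlgebra H} {p : H →L[ℂ] H}

/-- The states taking the value `1` on a decreasing sequence of nonzero projections. -/
theorem nonempty_orderStatesCut_isVanishing {Q : ℕ → saPart M}
    (hQ : IsVanishing fun n => (Q n : H →L[ℂ] H)) (hQ0 : ∀ n, (Q n : H →L[ℂ] H) ≠ 0) :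
    (orderStatesCut (saCone M) (saOne M) (Set.range fun n => (Q n, 1))).Nonempty := by
  have hex (n : ℕ) : ∃ v, v ≠ 0 ∧ (Q n : H →L[ℂ] H) v = v := by
    obtain ⟨w, hw⟩ := DFunLike.ne_iff.1 (hQ0 n)
    exact ⟨_, hw, (hQ.isProjection n).apply_apply w⟩
  choose v hv0 hv using hex
  have hcpt := isCompact_orderStatesCut (isOrderUnit_saOne (M := M)) ∅
  rw [orderStatesCut_empty] at hcpt
  obtain ⟨h, hh, hlim⟩ := hcpt.ultrafilter_le_nhds
    ((hyperfilter ℕ).map fun k => ⇑(vectorState M (v k)))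
    (le_principal_iff.2 (Filter.mem_map.2 (Filter.univ_mem' fun k => vectorState_mem (hv0 k))))
  have hlim' := tendsto_pi_nhds.1 (show Tendsto (fun k => ⇑(vectorState M (v k)))
    (hyperfilter ℕ) (𝓝 h) from hlim)
  refine ⟨h, hh, ?_⟩
  rintro _ ⟨n, rfl⟩
  refine tendsto_nhds_unique (hlim' (Q n)) (Tendsto.mono_left ?_ Nat.hyperfilter_le_atTop)
  refine tendsto_const_nhds.congr' ?_
  filter_upwards [eventually_ge_atTop n] with k hk
  have h1 : (Q n : H →L[ℂ] H) (v k) = v k := by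
    rw [← hv k]
    exact congr($(hQ.mul_of_le n k hk) (v k))
  have h2 : ‖v k‖ ^ 2 ≠ 0 := by simpa using hv0 k
  rw [vectorState_apply, h1, re_inner_self, div_self h2]

theorem isExtreme_orderStatesCut_of_le_one {Q : ℕ → saPart M}
    (hQ : ∀ n, (Q n : H →L[ℂ] H) ≤ 1) :
    IsExtreme ℝ (orderStates (saCone M) (saOne M))
      (orderStatesCut (saCone M) (saOne M) (Set.range fun n => (Q n, 1))) := by
  have hle {φ : saPart M → ℝ} (hφ : φ ∈ orderStates (saCone M) (saOne M)) (n : ℕ) :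
      φ (Q n) ≤ 1 := (orderState_mono hφ (y := saOne M) (hQ n)).trans_eq hφ.2.2
  refine ⟨fun φ hφ => hφ.1, ?_⟩
  rintro φ hφ ψ hψ χ hχ ⟨a, b, ha, hb, hab, rfl⟩
  refine ⟨hφ, ?_⟩
  rintro _ ⟨n, rfl⟩
  have h1 := hχ.2 _ ⟨n, rfl⟩
  simp only [Pi.add_apply, Pi.smul_apply, smul_eq_mul] at h1
  refine le_antisymm (hle hφ n) ?_
  have h2 := mul_le_mul_of_nonneg_left (hle hψ n) hb.le
  refine le_of_mul_le_mul_left (a := a) ?_ ha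
  change a * 1 ≤ a * φ (Q n)
  linarith

theorem exists_classically_normal_singular_pure_state [TopologicalSpace.SeparableSpace H]
    (CH : (2 : Cardinal.{0}) ^ Cardinal.aleph0 = Cardinal.aleph 1) (hpM : p ∈ M)
    (hp : IsProjection p) (hcen : ∀ x ∈ M, p * x = x * p) (hfac : CornerIsFactor M p)
    (hinf : ¬ FiniteDimensional ℂ ↥(Submodule.span ℂ (corner M p))) :
    ∃ f : ↥M →ₗ[ℂ] ℂ, IsPureStateOn M f ∧ IsSingularOn M f ∧ IsClassicallyNormalOn M f := by
  obtain ⟨Q, hQ, hQM, hQ0, hpQ⟩ := exists_isVanishing_of_not_finiteDimensional hpM hp hinf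
  let QS (n : ℕ) : saPart M := ⟨Q n, hQM n, (hQ.isProjection n).1⟩
  let pS : saPart M := ⟨p, hpM, hp.1⟩
  have hQle (n : ℕ) : Q n ≤ 1 := sub_nonneg.1 (hQ.isProjection n).one_sub.nonneg
  have hp1 : p ≤ 1 := sub_nonneg.1 hp.one_sub.nonneg
  have hQp : Q 0 ≤ p := by
    refine sub_nonneg.1 (hp.sub (hQ.isProjection 0) ⟨?_, hpQ 0⟩).nonneg
    rw [← hcen _ (hQM 0), hpQ]
  obtain ⟨ι, _, _, e, hι, he⟩ := exists_enumeration (H := H) CH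
  obtain ⟨φ, hφD, hφ, hgood⟩ := exists_extreme_state_forall_good hι (isOrderUnit_saOne (M := M))
    (fun i φ => (∀ n, e i n ∈ M) → IsVanishing (e i) → BreaksSequence M (e i) φ)
    (Set.countable_range fun n => (QS n, (1 : ℝ)))
    (nonempty_orderStatesCut_isVanishing (Q := QS) hQ hQ0)
    (isExtreme_orderStatesCut_of_le_one (Q := QS) hQle) (by
      intro i D hD hD₀ hne hext
      by_cases hi : (∀ n, e i n ∈ M) ∧ IsVanishing (e i)
      · obtain ⟨x, hx⟩ := exists_breaking_element hpM hp hcen hfac hi.2 hi.1 hD hne hext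
          fun φ hφ => by
            have h1 : φ (QS 0) = 1 := hφ.2 _ (hD₀ ⟨0, rfl⟩)
            have h2 := orderState_mono hφ.1 (x := QS 0) (y := pS) hQp
            have h3 := orderState_mono hφ.1 (x := pS) (y := saOne M) hp1
            rw [hφ.1.2.2] at h3
            exact le_antisymm h3 (h1 ▸ h2)
        exact ⟨x, fun φ hφ hmax _ _ => hx φ hφ hmax⟩
      · exact ⟨0, fun φ _ _ h1 h2 => absurd ⟨h1, h2⟩ hi⟩)
  obtain ⟨φ, rfl⟩ := hφ.1.1
  have hpure := isPureStateOn_complexify hφ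
  refine ⟨complexify φ, hpure, hpure.isSingularOn ?_,
    isClassicallyNormalOn_of_forall_breaksSequence hφ.1 fun Q' hM' hQ' => ?_⟩
  · refine not_isNormalOn_of_isVanishing (Q := fun n => ⟨Q n, hQM n⟩) hQ fun n => ?_
    rw [complexify_of_isSelfAdjoint φ (x := ⟨Q n, hQM n⟩) (hQ.isProjection n).1]
    exact_mod_cast hφD.2 (QS n, 1) ⟨n, rfl⟩
  · obtain ⟨i, rfl⟩ := he Q'
    exact hgood i hM' hQ'

end Construction

/-- Assuming the continuum hypothesis, a von Neumann algebra `M` acting on a separable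
Hilbert space has a classically normal, singular pure state iff there is a central
projection `p ∈ M` such that `pMp` is an infinite-dimensional factor. -/
theorem exists_classically_normal_singular_pure_state_iff
    (CH : (2 : Cardinal.{0}) ^ Cardinal.aleph0 = Cardinal.aleph 1)
    [TopologicalSpace.SeparableSpace H]
    (M : VonNeumannAlgebra H) :
    (∃ f : ↥M →ₗ[ℂ] ℂ,
        IsPureStateOn M f ∧ IsSingularOn M f ∧ IsClassicallyNormalOn M f) ↔
      ∃ p : ↥M, IsProjection ((p : H →L[ℂ] H)) ∧
        (∀ x ∈ M, (p : H →L[ℂ] H) * x = x * p) ∧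
        CornerIsFactor M (p : H →L[ℂ] H) ∧
        ¬ FiniteDimensional ℂ ↥(Submodule.span ℂ (corner M (p : H →L[ℂ] H))) := by
  constructor
  · rintro ⟨f, hf, hs, hc⟩
    exact exists_central_projection hf hs hc
  · rintro ⟨p, hp, hcen, hfac, hinf⟩
    exact exists_classically_normal_singular_pure_state CH p.2 hp hcen hfac hinf
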